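/- arXiv:2306.16637 — 11 statements merged into one kernel-verified Lean document; each statement's English description precedes it below -/
import Mathlib

section
/- Let A be a commutative monoid with zero. Then the following are equivalent: (1) there exist a field K and an injective monoid-with-zero homomorphism A →*₀ K (i.e. A is a domain); (2) there exist a field K of characteristic zero and an injective monoid-with-zero homomorphism A →*₀ K; (3) A is nontrivial (0 ≠ 1), A is integral (for all a, b, c ∈ A, a·b = a·c implies a = 0 or b = c), and for every α ∈ A and every natural number n ≥ 1 the set {x ∈ A | x^n = α} has extended cardinality at most n. -/
open Algebra in
/-- Finitely many elements of the Grothendieck group have a common denominator. -/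
theorem common_denom {M : Type*} [CommMonoid M] (t : Finset (GrothendieckGroup M)) :
    ∃ b : M, ∀ x ∈ t, ∃ a : M, x * GrothendieckGroup.of b = GrothendieckGroup.of a := by
  classical
  induction t using Finset.induction_on with
  | empty => exact ⟨1, by simp⟩
  | insert y t _ ih =>
    obtain ⟨b, hb⟩ := ih
    obtain ⟨⟨m, s⟩, hms⟩ := (Localization.monoidOf (⊤ : Submonoid M)).surj y
    refine ⟨b * s, fun x hx => ?_⟩
    rcases Finset.mem_insert.1 hx with rfl | hx
    · refine ⟨m * b, ?_⟩
      have h2 : x * GrothendieckGroup.of (s : M) = GrothendieckGroup.of m := hms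
      rw [map_mul, map_mul, mul_comm (GrothendieckGroup.of b), ← mul_assoc, h2]
    · obtain ⟨a, ha⟩ := hb x hx
      exact ⟨a * s, by rw [map_mul, map_mul, ← mul_assoc, ha]⟩

open Algebra in
theorem groth_torsion {M : Type*} [CommMonoid M] [IsCancelMul M]
    (h : ∀ (α : M) (n : ℕ), 1 ≤ n → {x : M | x ^ n = α}.encard ≤ (n : ℕ∞))
    (n : ℕ) (hn : 1 ≤ n) : {x : GrothendieckGroup M | x ^ n = 1}.encard ≤ (n : ℕ∞) := by
  by_contra hcon
  have h1 : ((n + 1 : ℕ) : ℕ∞) ≤ {x : GrothendieckGroup M | x ^ n = 1}.encard := by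
    push_cast
    exact Order.add_one_le_of_lt (not_le.1 hcon)
  obtain ⟨t, hts, htc⟩ := Set.exists_subset_encard_eq h1
  have htf : t.Finite := Set.finite_of_encard_eq_coe htc
  obtain ⟨b, hb⟩ := common_denom htf.toFinset
  have hb' : ∀ x : t, ∃ a : M, (x : GrothendieckGroup M) * GrothendieckGroup.of b =
      GrothendieckGroup.of a := fun x => hb x (by simp)
  choose a ha using hb'
  have hinj : Function.Injective a := by
    intro x y hxy
    have := (ha x).trans ((congrArg _ hxy).trans (ha y).symm)
    exact Subtype.ext (mul_right_cancel this)
  have hsub : Set.range a ⊆ {x : M | x ^ n = b ^ n} := by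
    rintro _ ⟨x, rfl⟩
    apply GrothendieckGroup.of_injective
    have hx : (x : GrothendieckGroup M) ^ n = 1 := hts x.2
    rw [map_pow, ← ha x, mul_pow, hx, one_mul, map_pow]
  have h2 := (Set.encard_le_encard hsub).trans (h (b ^ n) n hn)
  have h3 : (Set.range a).encard = t.encard := by
    rw [← Set.image_univ, hinj.encard_image, Set.encard_univ, Set.encard]
  rw [h3, htc] at h2
  have := Nat.cast_le.1 h2
  omega

/-- In a group with at most `p` solutions of `p • x = 0`, the `p`-torsion embeds into the
units of an algebraically closed field of characteristic zero. -/
theorem embed_ptors {G K : Type*} [AddCommGroup G] [Field K] [IsAlgClosed K] [CharZero K]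
    (p : ℕ) (hp : p.Prime) (h : {x : G | p • x = 0}.encard ≤ (p : ℕ∞)) :
    ∃ f : Submodule.torsionBy ℤ G (p : ℤ) →ₗ[ℤ] Additive Kˣ, Function.Injective f := by
  have : Fact p.Prime := ⟨hp⟩
  set T := Submodule.torsionBy ℤ G (p : ℤ) with hT
  by_cases hsub : Subsingleton T
  · exact ⟨0, fun x y _ => Subsingleton.elim _ _⟩
  rw [not_subsingleton_iff_nontrivial] at hsub
  obtain ⟨y, hy⟩ := exists_ne (0 : T)
  have hset : (T : Set G) = {x : G | p • x = 0} := by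
    ext x; simp [hT, Submodule.mem_torsionBy_iff]
  have hT2 : (T : Set G).encard ≤ p := by rw [hset]; exact h
  have hfin : Finite T := Set.finite_of_encard_le_coe hT2
  have hcard : Nat.card T ≤ p := by
    have := (T : Set G).toFinite.cast_ncard_eq
    rw [← this] at hT2
    exact Nat.cast_le.1 hT2
  have hyo : addOrderOf y = p := by
    refine addOrderOf_eq_prime ?_ hy
    have := y.2
    rw [Submodule.mem_torsionBy_iff] at this
    ext
    rw [natCast_zsmul] at this
    exact this
  have hdvd : p ∣ Nat.card T := hyo ▸ addOrderOf_dvd_natCard y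
  have hTc : Nat.card T = p := le_antisymm hcard (Nat.le_of_dvd Nat.card_pos hdvd)
  have : NeZero (p : K) := ⟨by exact_mod_cast hp.ne_zero⟩
  obtain ⟨ζ, hζ⟩ := HasEnoughRootsOfUnity.exists_primitiveRoot K p
  have hR : Nat.card (Additive (rootsOfUnity p K)) = p := hζ.card_rootsOfUnity
  let e : T ≃+ Additive (rootsOfUnity p K) := addEquivOfPrimeCardEq hTc hR
  let g : Additive (rootsOfUnity p K) →+ Additive Kˣ :=
    MonoidHom.toAdditive (rootsOfUnity p K).subtype
  refine ⟨(g.comp e.toAddMonoidHom).toIntLinearMap, ?_⟩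
  intro x y hxy
  apply e.injective
  exact Subtype.val_injective hxy

theorem baer_units {K : Type*} [Field K] [IsAlgClosed K] : Module.Baer ℤ (Additive Kˣ) := by
  haveI : RootableBy Kˣ ℕ := rootableByOfPowLeftSurj Kˣ ℕ (by
    intro n hn x
    obtain ⟨z, hz⟩ := IsAlgClosed.exists_pow_nat_eq (x : K) (Nat.pos_of_ne_zero hn)
    have hz0 : z ≠ 0 := by
      rintro rfl
      rw [zero_pow hn] at hz
      exact x.ne_zero hz.symm
    exact ⟨Units.mk0 z hz0, Units.ext (by simpa using hz)⟩)
  letI : DivisibleBy (Additive Kˣ) ℕ :=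
    { div := fun a n => Additive.ofMul (RootableBy.root a.toMul n)
      div_zero := fun a => congrArg Additive.ofMul (RootableBy.root_zero a.toMul)
      div_cancel := fun a hn => congrArg Additive.ofMul (RootableBy.root_cancel a.toMul hn) }
  letI : DivisibleBy (Additive Kˣ) ℤ := AddGroup.divisibleByIntOfDivisibleByNat _
  exact Module.Baer.of_divisible _

theorem exists_hom_inj_on_torsion {G K : Type*} [AddCommGroup G] [Field K] [IsAlgClosed K]
    [CharZero K] (h : ∀ n : ℕ, 1 ≤ n → {x : G | n • x = 0}.encard ≤ (n : ℕ∞)) :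
    ∃ f : G →ₗ[ℤ] Additive Kˣ, ∀ x : G, IsOfFinAddOrder x → f x = 0 → x = 0 := by
  classical
  choose f hf using fun p : Nat.Primes => embed_ptors (G := G) (K := K) p p.2 (h p p.2.one_le)
  have hind : iSupIndep fun p : Nat.Primes => Submodule.torsionBy ℤ G ((p : ℕ) : ℤ) := by
    rw [iSupIndep_iff_supIndep]
    intro s
    apply Submodule.supIndep_torsionBy
    intro p _ q _ hpq
    refine Nat.isCoprime_iff_coprime.2 ((Nat.coprime_primes p.2 q.2).2 fun h => hpq ?_)
    exact Subtype.ext h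
  obtain ⟨F, hF⟩ := (baer_units (K := K)).extension_property _ hind.dfinsupp_lsum_injective
    (DFinsupp.lsum ℕ f)
  have hFp : ∀ (p : Nat.Primes) (x : Submodule.torsionBy ℤ G ((p : ℕ) : ℤ)), F x = f p x := by
    intro p x
    have := LinearMap.congr_fun hF (DFinsupp.single p x)
    simpa using this
  refine ⟨F, fun x hx hFx => ?_⟩
  by_contra hx0
  have ho : addOrderOf x ≠ 1 := by simpa using hx0
  obtain ⟨p, hp, k, hk⟩ := Nat.exists_prime_and_dvd ho
  have hmem : k • x ∈ Submodule.torsionBy ℤ G (((⟨p, hp⟩ : Nat.Primes) : ℕ) : ℤ) := by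
    rw [Submodule.mem_torsionBy_iff]
    change (p : ℤ) • k • x = 0
    rw [natCast_zsmul, smul_smul, ← hk, addOrderOf_nsmul_eq_zero]
  have h1 := hFp ⟨p, hp⟩ ⟨k • x, hmem⟩
  have h2 : F (k • x) = 0 := by rw [map_nsmul, hFx, smul_zero]
  have h3 := hf ⟨p, hp⟩ ((h1.symm.trans h2).trans (map_zero _).symm)
  have h4 : k • x = 0 := congrArg Subtype.val h3
  have h5 := addOrderOf_dvd_of_nsmul_eq_zero h4
  have hpos := hx.addOrderOf_pos
  have hk0 : 0 < k := Nat.pos_of_ne_zero (by rintro rfl; omega)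
  have := Nat.le_of_dvd hk0 h5
  have := hp.two_le
  nlinarith

theorem uniqueProds_of_torsionFree (F : Type*) [CommGroup F] [IsMulTorsionFree F] :
    UniqueProds F := by
  have h1 : UniqueSums (Additive F) :=
    UniqueSums.of_injective_addHom (DivisibleHull.coeAddMonoidHom (M := Additive F)).toAddHom
      DivisibleHull.coe_injective inferInstance
  exact (inferInstance : UniqueProds (Multiplicative (Additive F)))

theorem group_embed (G : Type u) [CommGroup G]
    (h : ∀ n : ℕ, 1 ≤ n → {x : G | x ^ n = 1}.encard ≤ (n : ℕ∞)) :
    ∃ (K : Type u) (_ : Field K) (_ : CharZero K), ∃ f : G →* K, Function.Injective f := by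
  let K := AlgebraicClosure (ULift.{u} ℚ)
  have : CharZero (ULift.{u} ℚ) := ⟨fun a b hab => by
    exact_mod_cast congrArg ULift.down hab⟩
  have : CharZero K := charZero_of_injective_algebraMap (algebraMap (ULift.{u} ℚ) K).injective
  obtain ⟨f, hf⟩ := exists_hom_inj_on_torsion (G := Additive G) (K := K) h
  let F := G ⧸ CommGroup.torsion G
  have : UniqueProds F := uniqueProds_of_torsionFree F
  let R := MonoidAlgebra K F
  have : IsDomain R := NoZeroDivisors.to_isDomain R
  let g : G →* R :=
    { toFun := fun x => MonoidAlgebra.single (x : F) ((f (Additive.ofMul x)).toMul : K)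
      map_one' := by
        simp only [ofMul_one, map_zero, toMul_zero, Units.val_one, QuotientGroup.mk_one]
        exact MonoidAlgebra.one_def.symm
      map_mul' := fun x y => by
        simp only [ofMul_mul, map_add, toMul_add, Units.val_mul, QuotientGroup.mk_mul]
        exact (MonoidAlgebra.single_mul_single ..).symm }
  have hg : Function.Injective g := by
    rw [injective_iff_map_eq_one]
    intro x hx
    have hx' : MonoidAlgebra.single (x : F) ((f (Additive.ofMul x)).toMul : K) =
      MonoidAlgebra.single 1 1 := hx
    rcases MonoidAlgebra.single_inj.1 hx' with ⟨h1, h2⟩ | ⟨_, h2⟩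
    · have ht : x ∈ CommGroup.torsion G := (QuotientGroup.eq_one_iff x).1 h1
      have ht' : IsOfFinAddOrder (Additive.ofMul x) :=
        isOfFinAddOrder_ofMul_iff.2 ((CommGroup.mem_torsion x).1 ht)
      have h3 : (f (Additive.ofMul x)).toMul = 1 := Units.ext h2
      exact congrArg Additive.toMul (hf _ ht' h3)
    · exact absurd h2 one_ne_zero
  have : CharZero R := charZero_of_injective_algebraMap (R := K)
    (algebraMap K R).injective
  have : CharZero (FractionRing R) := charZero_of_injective_algebraMap (R := R)
    (IsFractionRing.injective R (FractionRing R))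
  exact ⟨FractionRing R, inferInstance, inferInstance,
    (algebraMap R (FractionRing R) : R →* FractionRing R).comp g,
    (IsFractionRing.injective R (FractionRing R)).comp hg⟩

theorem three_imp_two {A : Type u} [CommMonoidWithZero A] (h0 : (0 : A) ≠ 1)
    (hc : ∀ a b c : A, a * b = a * c → a = 0 ∨ b = c)
    (h : ∀ (α : A) (n : ℕ), 1 ≤ n → {x : A | x ^ n = α}.encard ≤ (n : ℕ∞)) :
    ∃ (K : Type u) (_ : Field K) (_ : CharZero K), ∃ f : A →*₀ K, Function.Injective f := by
  classical
  have hmul : ∀ a b : A, a ≠ 0 → b ≠ 0 → a * b ≠ 0 := fun a b ha hb hab =>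
    (hc a b 0 (by rw [hab, mul_zero])).elim ha hb
  let M : Submonoid A :=
    { carrier := {a | a ≠ 0}
      one_mem' := h0.symm
      mul_mem' := fun {a b} ha hb => hmul a b ha hb }
  have : IsLeftCancelMul M := ⟨fun a b c hbc =>
    Subtype.ext ((hc a b c (congrArg Subtype.val hbc)).resolve_left a.2)⟩
  have : IsCancelMul M := CommMagma.IsLeftCancelMul.toIsCancelMul M
  have hM : ∀ (α : M) (n : ℕ), 1 ≤ n → {x : M | x ^ n = α}.encard ≤ (n : ℕ∞) := by
    intro α n hn
    refine le_trans ?_ (h α n hn)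
    rw [← Subtype.val_injective.encard_image]
    apply Set.encard_le_encard
    rintro _ ⟨x, hx, rfl⟩
    exact congrArg Subtype.val hx
  obtain ⟨K, _, _, f, hf⟩ := group_embed (Algebra.GrothendieckGroup M) (groth_torsion hM)
  have hf0 : ∀ x, f x ≠ 0 := fun x => ((Group.isUnit x).map f).ne_zero
  have hof := Algebra.GrothendieckGroup.of_injective (M := M)
  refine ⟨K, inferInstance, inferInstance,
    { toFun := fun a => if ha : a = 0 then 0 else f (Algebra.GrothendieckGroup.of (⟨a, ha⟩ : M))
      map_zero' := by simp
      map_one' := ?_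
      map_mul' := ?_ }, ?_⟩
  · rw [dif_neg h0.symm]
    exact (congrArg f (map_one Algebra.GrothendieckGroup.of)).trans (map_one f)
  · intro a b
    by_cases ha : a = 0
    · simp [ha]
    by_cases hb : b = 0
    · simp [hb]
    rw [dif_neg ha, dif_neg hb, dif_neg (hmul a b ha hb), ← map_mul, ← map_mul]
    rfl
  · intro a b hab
    change (if ha : a = 0 then 0 else f (Algebra.GrothendieckGroup.of (⟨a, ha⟩ : M))) =
      (if ha : b = 0 then 0 else f (Algebra.GrothendieckGroup.of (⟨b, ha⟩ : M))) at hab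
    by_cases ha : a = 0 <;> by_cases hb : b = 0
    · rw [ha, hb]
    · rw [dif_pos ha, dif_neg hb] at hab
      exact absurd hab.symm (hf0 _)
    · rw [dif_neg ha, dif_pos hb] at hab
      exact absurd hab (hf0 _)
    · rw [dif_neg ha, dif_neg hb] at hab
      exact congrArg Subtype.val (hof (hf hab))

theorem one_imp_three {A K : Type*} [CommMonoidWithZero A] [Field K] (f : A →*₀ K)
    (hf : Function.Injective f) : (0 : A) ≠ 1 ∧ (∀ a b c : A, a * b = a * c → a = 0 ∨ b = c) ∧
        ∀ (α : A) (n : ℕ), 1 ≤ n → {x : A | x ^ n = α}.encard ≤ (n : ℕ∞) := by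
  classical
  refine ⟨fun h => ?_, fun a b c h => ?_, fun α n hn => ?_⟩
  · have := congrArg f h
    simp at this
  · have := congrArg f h
    rw [map_mul, map_mul] at this
    rcases mul_eq_mul_left_iff.1 this with h | h
    · exact Or.inr (hf h)
    · exact Or.inl (hf (h.trans (map_zero f).symm))
  · rw [← hf.encard_image]
    have hsub : f '' {x : A | x ^ n = α} ⊆ ((Polynomial.nthRoots n (f α)).toFinset : Set K) := by
      rintro _ ⟨x, hx, rfl⟩
      have hx : x ^ n = α := hx
      simp [Polynomial.mem_nthRoots hn, ← map_pow, hx]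
    refine (Set.encard_le_encard hsub).trans ?_
    rw [Set.encard_coe_eq_coe_finsetCard]
    have hle := (Multiset.toFinset_card_le (Polynomial.nthRoots n (f α))).trans
      (Polynomial.card_nthRoots n (f α))
    exact Nat.cast_le.2 hle

/-- A commutative monoid with zero `A` is a *domain* (embeds into a field by an
injective monoid-with-zero homomorphism) iff it embeds into a field of characteristic zero,
iff `A` is nontrivial, integral, and every equation `x ^ n = α` has at most `n` solutions. -/
theorem domain_characterization {A : Type u} [CommMonoidWithZero A] :
    ((∃ (K : Type u) (_ : Field K), ∃ f : A →*₀ K, Function.Injective f) ↔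
      (∃ (K : Type u) (_ : Field K) (_ : CharZero K), ∃ f : A →*₀ K, Function.Injective f)) ∧
    ((∃ (K : Type u) (_ : Field K), ∃ f : A →*₀ K, Function.Injective f) ↔
      ((0 : A) ≠ 1 ∧ (∀ a b c : A, a * b = a * c → a = 0 ∨ b = c) ∧
        ∀ (α : A) (n : ℕ), 1 ≤ n → {x : A | x ^ n = α}.encard ≤ (n : ℕ∞))) := by
  refine ⟨⟨?_, ?_⟩, ⟨?_, ?_⟩⟩
  · rintro ⟨K, _, f, hf⟩
    obtain ⟨h1, h2, h3⟩ := one_imp_three f hf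
    exact three_imp_two h1 h2 h3
  · rintro ⟨K, _, _, f, hf⟩
    exact ⟨K, inferInstance, f, hf⟩
  · rintro ⟨K, _, f, hf⟩
    exact one_imp_three f hf
  · rintro ⟨h1, h2, h3⟩
    obtain ⟨K, _, _, f, hf⟩ := three_imp_two h1 h2 h3
    exact ⟨K, inferInstance, f, hf⟩
end

section
/- Let Γ be a subgroup of ℂˣ all of whose elements have finite order, let λ ∈ Γ and let n ≥ 1 be a natural number such that there is no divisor d > 1 of n and no θ ∈ Γ with θ^d = λ. Let ω ∈ ℂ with ω^n = λ, and let f : M(Γ) →*₀ ℂ be the monoid-with-zero homomorphism sending the nonzero element (γ, k) to γ·ω^k (and 0 to 0). Then the congruence kernel of f equals conGen {(T^n, λ)}; in particular conGen {(T^n, λ)} is a Γ-congruence on M(Γ). -/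
open Multiplicative

/-- The monomial pointed monoid `Γ[T]`, modeled as `WithZero (Γ × Multiplicative ℕ)`:
the nonzero element `(γ, k)` represents the monomial `γ·T^k`. -/
abbrev MGamma (Γ : Subgroup ℂˣ) : Type := WithZero (Γ × Multiplicative ℕ)

/-- The element `T` of `Γ[T]`. -/
noncomputable def Tgen (Γ : Subgroup ℂˣ) : MGamma Γ := (((1 : Γ), ofAdd 1) : Γ × Multiplicative ℕ)

/-- The constant `γ ∈ Γ`, viewed as an element of `Γ[T]`. -/
noncomputable def constE {Γ : Subgroup ℂˣ} (γ : Γ) : MGamma Γ := ((γ, ofAdd 0) : Γ × Multiplicative ℕ)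

/-- The congruence generated by the single pair `(a, b)`. -/
def conGenPair {M : Type*} [Mul M] (a b : M) : Con M := conGen (fun x y => x = a ∧ y = b)

/-- A congruence `c` on `M` is a strong prime congruence if it is the congruence kernel of a
monoid-with-zero homomorphism from `M` to some field. -/
def IsStrongPrimeCon {M : Type*} [CommMonoidWithZero M] (c : Con M) : Prop :=
  ∃ (K : Type) (_ : Field K), ∃ f : M →*₀ K, Con.ker f.toMonoidHom = c

/-- A congruence `c` on `Γ[T]` is a `Γ`-congruence if it is a strong prime congruence and
distinct constants remain distinct modulo `c`. -/
def IsGammaCon (Γ : Subgroup ℂˣ) (c : Con (MGamma Γ)) : Prop :=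
  IsStrongPrimeCon c ∧ ∀ γ δ : Γ, c (constE γ) (constE δ) → γ = δ

lemma dvd_of_pow_mem_aux (Γ : Subgroup ℂˣ) (l : Γ) (n : ℕ) (hn : 1 ≤ n)
    (hl : ¬ ∃ (d : ℕ) (θ : Γ), d ∣ n ∧ 1 < d ∧ θ ^ d = l)
    (w : ℂˣ) (hw : w ^ n = (l : ℂˣ)) (m : ℕ) (hm : w ^ m ∈ Γ) : n ∣ m := by
  have hg : w ^ (Nat.gcd n m) ∈ Γ := by
    have h1 : w ^ (Nat.gcd n m) = (w ^ n) ^ (Nat.gcdA n m) * (w ^ m) ^ (Nat.gcdB n m) := by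
      rw [← zpow_natCast w (Nat.gcd n m), Nat.gcd_eq_gcd_ab, zpow_add, zpow_mul, zpow_mul,
        zpow_natCast, zpow_natCast]
    rw [h1]
    refine Γ.mul_mem (Γ.zpow_mem ?_ _) (Γ.zpow_mem hm _)
    rw [hw]; exact l.2
  obtain ⟨d, hd⟩ := Nat.gcd_dvd_left n m
  have hdpos : 0 < d := by
    rcases Nat.eq_zero_or_pos d with h | h
    · rw [h] at hd; omega
    · exact h
  rcases Nat.lt_or_ge 1 d with h | h
  · exfalso
    refine hl ⟨d, ⟨_, hg⟩, ⟨_, by rw [mul_comm]; exact hd⟩, h, ?_⟩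
    apply Subtype.ext
    rw [Subgroup.coe_pow, ← pow_mul, ← hd, hw]
  · have : d = 1 := by omega
    subst this
    rw [mul_one] at hd
    rw [hd]
    exact Nat.gcd_dvd_right n m

lemma constE_mul_T_aux (Γ : Subgroup ℂˣ) (γ : Γ) (k : ℕ) :
    (((γ, ofAdd k) : Γ × Multiplicative ℕ) : MGamma Γ) = constE γ * Tgen Γ ^ k := by
  rw [constE, Tgen, ← WithZero.coe_pow, ← WithZero.coe_mul]
  congr 1
  ext <;> simp

lemma constE_pow_aux {Γ : Subgroup ℂˣ} (γ : Γ) (k : ℕ) :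
    constE (γ ^ k) = constE γ ^ k := by
  rw [constE, constE, ← WithZero.coe_pow]
  congr 1

lemma constE_mul_aux {Γ : Subgroup ℂˣ} (γ δ : Γ) :
    constE (γ * δ) = constE γ * constE δ := by
  rw [constE, constE, constE, ← WithZero.coe_mul]
  congr 1

/-- if no divisor `d > 1` of `n` admits a `d`-th root `θ ∈ Γ` of `λ`, and
`ω ∈ ℂ` satisfies `ω ^ n = λ`, then the congruence kernel of the evaluation map
`Γ[T] →*₀ ℂ`, `γ·T^k ↦ γ·ω^k`, is `⟨T^n ~ λ⟩`; in particular `⟨T^n ~ λ⟩` is a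
`Γ`-congruence on `Γ[T]`. -/
theorem congKer_eval_eq_conGenPair (Γ : Subgroup ℂˣ) (hΓ : ∀ γ : Γ, IsOfFinOrder γ)
    (l : Γ) (n : ℕ) (hn : 1 ≤ n)
    (hl : ¬ ∃ (d : ℕ) (θ : Γ), d ∣ n ∧ 1 < d ∧ θ ^ d = l)
    (ω : ℂ) (hω : ω ^ n = ((l : ℂˣ) : ℂ))
    (f : MGamma Γ →*₀ ℂ)
    (hf : ∀ (γ : Γ) (k : ℕ), f (((γ, ofAdd k) : Γ × Multiplicative ℕ) : MGamma Γ)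
      = ((γ : ℂˣ) : ℂ) * ω ^ k) :
    Con.ker f.toMonoidHom = conGenPair (Tgen Γ ^ n) (constE l) ∧
      IsGammaCon Γ (conGenPair (Tgen Γ ^ n) (constE l)) := by
  obtain ⟨w, rfl⟩ : IsUnit ω := by
    rw [← isUnit_pow_iff (n := n) (by omega), hω]
    exact Units.isUnit _
  have hw : w ^ n = (l : ℂˣ) := Units.ext (by simpa using hω)
  have hT : f (Tgen Γ) = w := by rw [Tgen, hf]; simp
  have hc : ∀ γ : Γ, f (constE γ) = ((γ : ℂˣ) : ℂ) := fun γ => by rw [constE, hf]; simp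
  have hrel : conGenPair (Tgen Γ ^ n) (constE l) (Tgen Γ ^ n) (constE l) :=
    ConGen.Rel.of _ _ ⟨rfl, rfl⟩
  set c := conGenPair (Tgen Γ ^ n) (constE l) with hcdef
  have key : ∀ (γ δ : Γ) (j k : ℕ), j ≤ k →
      ((γ : ℂˣ) : ℂ) * (w : ℂ) ^ j = ((δ : ℂˣ) : ℂ) * (w : ℂ) ^ k →
      c (constE γ * Tgen Γ ^ j) (constE δ * Tgen Γ ^ k) := by
    intro γ δ j k hjk h
    obtain ⟨m, rfl⟩ := Nat.exists_eq_add_of_le hjk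
    have h1 : (γ : ℂˣ) * w ^ j = (δ : ℂˣ) * w ^ (j + m) := Units.ext (by simpa using h)
    have h2 : (γ : ℂˣ) = δ * w ^ m := by
      rw [pow_add, mul_comm (w ^ j), ← mul_assoc] at h1
      exact mul_right_cancel h1
    have hm : w ^ m ∈ Γ := by
      have : w ^ m = (δ : ℂˣ)⁻¹ * γ := by rw [h2]; simp
      rw [this]
      exact Γ.mul_mem (Γ.inv_mem δ.2) γ.2
    obtain ⟨q, rfl⟩ := dvd_of_pow_mem_aux Γ l n hn hl w hw m hm
    have h3 : γ = δ * l ^ q := by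
      apply Subtype.ext
      rw [h2, pow_mul, hw]; rfl
    rw [h3, constE_mul_aux, constE_pow_aux, pow_add, pow_mul, mul_assoc, mul_comm (constE l ^ q)]
    exact c.mul (c.refl _) (c.mul (c.refl _) (c.symm (c.pow q hrel)))
  have main : Con.ker f.toMonoidHom = c := by
    apply le_antisymm
    · intro x y hxy
      have hxy : f x = f y := hxy
      have nz : ∀ a : Γ × Multiplicative ℕ, f (a : MGamma Γ) ≠ 0 := by
        rintro ⟨γ, k⟩
        have := hf γ (toAdd k)
        rw [ofAdd_toAdd] at this
        rw [this]
        simp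
      induction x using WithZero.recZeroCoe with
      | zero =>
        induction y using WithZero.recZeroCoe with
        | zero => exact c.refl _
        | coe b => exact absurd (by rw [← hxy, map_zero]) (nz b)
      | coe a =>
        induction y using WithZero.recZeroCoe with
        | zero => exact absurd (by rw [hxy, map_zero]) (nz a)
        | coe b =>
          obtain ⟨γ, j⟩ := a
          obtain ⟨δ, k⟩ := b
          obtain ⟨j, rfl⟩ := ofAdd.surjective j
          obtain ⟨k, rfl⟩ := ofAdd.surjective k
          rw [hf, hf] at hxy
          rw [constE_mul_T_aux, constE_mul_T_aux]
          rcases le_total j k with h | h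
          · exact key _ _ _ _ h hxy
          · exact c.symm (key _ _ _ _ h hxy.symm)
    · rw [hcdef, conGenPair]
      refine Con.conGen_le.2 ?_
      rintro x y ⟨rfl, rfl⟩
      change f _ = f _
      rw [map_pow, hT, hc, hω]
  refine ⟨main, ⟨ℂ, inferInstance, f, main⟩, ?_⟩
  intro γ δ h
  rw [← main] at h
  have h : f _ = f _ := h
  rw [hc, hc] at h
  exact Subtype.ext (Units.ext h)
end

section
/- Let Γ be a subgroup of ℂˣ all of whose elements have finite order. Then every Γ-congruence c on M(Γ) is either the equality congruence ⊥, or conGen {(T, 0)}, or of the form conGen {(T^n, λ)} for some natural number n ≥ 1 and some λ ∈ Γ. -/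
open Multiplicative

theorem constE_mul {Γ : Subgroup ℂˣ} (a b : Γ) : constE (a * b) = constE a * constE b := rfl

theorem constE_one {Γ : Subgroup ℂˣ} : constE (1 : Γ) = 1 := rfl

theorem constE_pow {Γ : Subgroup ℂˣ} (a : Γ) (n : ℕ) : constE (a ^ n) = constE a ^ n := by
  induction n with
  | zero => rw [pow_zero, pow_zero, constE_one]
  | succ n ih => rw [pow_succ, pow_succ, constE_mul, ih]

theorem Tgen_pow (Γ : Subgroup ℂˣ) (n : ℕ) :
    Tgen Γ ^ n = (((1 : Γ), ofAdd n) : Γ × Multiplicative ℕ) := by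
  induction n with
  | zero => rfl
  | succ n ih =>
    rw [pow_succ, ih, Tgen, ← WithZero.coe_mul, Prod.mk_mul_mk, one_mul, ofAdd_add]

theorem mgamma_cases {Γ : Subgroup ℂˣ} (x : MGamma Γ) :
    x = 0 ∨ ∃ (γ : Γ) (k : ℕ), x = constE γ * Tgen Γ ^ k := by
  induction x using WithZero.recZeroCoe with
  | zero => exact Or.inl rfl
  | coe p =>
    right
    refine ⟨p.1, toAdd p.2, ?_⟩
    rw [Tgen_pow, constE, ← WithZero.coe_mul, Prod.mk_mul_mk, mul_one, ← ofAdd_add, zero_add]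
    rfl

theorem f_const_ne {Γ : Subgroup ℂˣ} {K : Type} [Field K] (f : MGamma Γ →*₀ K) (γ : Γ) :
    f (constE γ) ≠ 0 := by
  intro h
  have h1 : f (constE γ) * f (constE γ⁻¹) = 1 := by
    rw [← map_mul, ← constE_mul, mul_inv_cancel, constE_one, map_one]
  rw [h, zero_mul] at h1
  exact zero_ne_one h1

theorem ker_le_aux {Γ : Subgroup ℂˣ} {K : Type} [Field K] (f : MGamma Γ →*₀ K)
    (ht : f (Tgen Γ) ≠ 0) (d : Con (MGamma Γ))
    (hd : ∀ (k : ℕ) (γ : Γ), f (Tgen Γ) ^ k = f (constE γ) → d (Tgen Γ ^ k) (constE γ))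
    (x y : MGamma Γ) (h : f x = f y) : d x y := by
  have key : ∀ (γ δ : Γ) (k e : ℕ),
      f (constE γ * Tgen Γ ^ k) = f (constE δ * Tgen Γ ^ (k + e)) →
      d (constE δ * Tgen Γ ^ (k + e)) (constE γ * Tgen Γ ^ k) := by
    intro γ δ k e h
    have h1 : f (Tgen Γ) ^ e = f (constE (δ⁻¹ * γ)) := by
      have h2 : f (constE γ) = f (constE δ) * f (constE (δ⁻¹ * γ)) := by
        rw [← map_mul, ← constE_mul, mul_inv_cancel_left]
      simp only [map_mul, map_pow, pow_add] at h
      rw [h2] at h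
      have h3 := pow_ne_zero k ht
      have h4 := f_const_ne f δ
      apply mul_left_cancel₀ (mul_ne_zero h4 h3)
      linear_combination -h
    have h5 := d.mul (d.refl (constE δ * Tgen Γ ^ k)) (hd e _ h1)
    have h6 : constE γ * Tgen Γ ^ k = constE δ * Tgen Γ ^ k * constE (δ⁻¹ * γ) := by
      rw [mul_right_comm, ← constE_mul, mul_inv_cancel_left]
    rw [h6, pow_add, ← mul_assoc]
    exact h5
  have hne : ∀ (γ : Γ) (k : ℕ), f (constE γ * Tgen Γ ^ k) ≠ 0 := by
    intro γ k
    rw [map_mul, map_pow]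
    exact mul_ne_zero (f_const_ne f γ) (pow_ne_zero k ht)
  rcases mgamma_cases x with rfl | ⟨γ, k, rfl⟩
  · rcases mgamma_cases y with rfl | ⟨δ, m, rfl⟩
    · exact d.refl _
    · rw [map_zero] at h
      exact absurd h.symm (hne _ _)
  · rcases mgamma_cases y with rfl | ⟨δ, m, rfl⟩
    · rw [map_zero] at h
      exact absurd h (hne _ _)
    · rcases le_total k m with hkm | hkm
      · obtain ⟨e, rfl⟩ := Nat.exists_eq_add_of_le hkm
        exact d.symm (key _ _ _ _ h)
      · obtain ⟨e, rfl⟩ := Nat.exists_eq_add_of_le hkm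
        exact key _ _ _ _ h.symm

theorem conGenPair_le {M : Type*} [Mul M] {a b : M} {c : Con M} (h : c a b) :
    conGenPair a b ≤ c := by
  apply Con.conGen_le.2
  rintro x y ⟨rfl, rfl⟩
  exact h

theorem conGenPair_rel {M : Type*} [Mul M] (a b : M) : conGenPair a b a b :=
  ConGen.Rel.of _ _ ⟨rfl, rfl⟩

/-- every `Γ`-congruence on `Γ[T]` is the equality congruence `⊥`, or
`⟨T ~ 0⟩`, or `⟨T^n ~ λ⟩` for some `n ≥ 1` and `λ ∈ Γ`. -/
theorem gammaCon_classification (Γ : Subgroup ℂˣ) (hΓ : ∀ γ : Γ, IsOfFinOrder γ)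
    (c : Con (MGamma Γ)) (hc : IsGammaCon Γ c) :
    c = ⊥ ∨ c = conGenPair (Tgen Γ) 0 ∨
      ∃ (n : ℕ) (l : Γ), 1 ≤ n ∧ c = conGenPair (Tgen Γ ^ n) (constE l) := by
  classical
  obtain ⟨⟨K, _, f, rfl⟩, hinj⟩ := hc
  have hk : ∀ x y, Con.ker f.toMonoidHom x y ↔ f x = f y := fun x y => Iff.rfl
  simp only [hk] at hinj
  by_cases ht : f (Tgen Γ) = 0
  · right; left
    apply le_antisymm
    · have hz : ∀ x, f x = 0 → conGenPair (Tgen Γ) 0 x 0 := by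
        intro x hx
        rcases mgamma_cases x with rfl | ⟨γ, k, rfl⟩
        · exact Con.refl _ _
        · rcases k with _ | k
          · rw [pow_zero, mul_one] at hx
            exact absurd hx (f_const_ne f γ)
          · have := Con.mul _ (Con.refl _ (constE γ * Tgen Γ ^ k)) (conGenPair_rel (Tgen Γ) 0)
            rw [mul_zero, mul_assoc, ← pow_succ] at this
            exact this
      have hnz : ∀ x, f x ≠ 0 → ∃ γ, x = constE γ := by
        intro x hx
        rcases mgamma_cases x with rfl | ⟨γ, k, rfl⟩
        · exact absurd (map_zero f) hx
        · rcases k with _ | k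
          · exact ⟨γ, by rw [pow_zero, mul_one]⟩
          · refine absurd ?_ hx
            rw [map_mul, map_pow, ht, pow_succ, mul_zero, mul_zero]
      intro x y h
      replace h := (hk x y).1 h
      by_cases hx : f x = 0
      · exact Con.trans _ (hz x hx) (Con.symm _ (hz y (h ▸ hx)))
      · obtain ⟨γ, rfl⟩ := hnz x hx
        obtain ⟨δ, rfl⟩ := hnz y (h ▸ hx)
        rw [hinj _ _ h]
        exact Con.refl _ _
    · apply conGenPair_le
      rw [hk, ht, map_zero]
  · by_cases hex : ∃ n : ℕ, 1 ≤ n ∧ ∃ l : Γ, f (Tgen Γ) ^ n = f (constE l)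
    · right; right
      obtain ⟨hn, l, hl⟩ := Nat.find_spec hex
      have hmin := fun m => Nat.find_min (m := m) hex
      generalize Nat.find hex = n at hn hl hmin
      refine ⟨n, l, hn, le_antisymm ?_ ?_⟩
      · intro x y h
        refine ker_le_aux f ht _ ?_ x y ((hk x y).1 h)
        intro k γ hγ
        have hkd := Nat.div_add_mod k n
        have hr : f (Tgen Γ) ^ (k % n) = f (constE ((l ^ (k / n))⁻¹ * γ)) := by
          have h2 : f (constE γ) = f (constE l) ^ (k / n) * f (constE ((l ^ (k / n))⁻¹ * γ)) := by
            rw [← map_pow, ← map_mul, ← constE_pow, ← constE_mul, mul_inv_cancel_left]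
          rw [← hkd, pow_add, pow_mul, hl, h2] at hγ
          exact mul_left_cancel₀ (pow_ne_zero _ (f_const_ne f l)) hγ
        have hr0 : k % n = 0 := by
          by_contra h0
          exact hmin _ (Nat.mod_lt _ hn) ⟨Nat.one_le_iff_ne_zero.2 h0, _, hr⟩
        rw [hr0, pow_zero, ← map_one f, ← constE_one] at hr
        have hg : γ = l ^ (k / n) := (inv_mul_eq_one.1 (hinj _ _ hr).symm).symm
        rw [hr0, add_zero] at hkd
        have h7 := Con.pow _ (k / n) (conGenPair_rel (Tgen Γ ^ n) (constE l))
        rw [← pow_mul, hkd, ← constE_pow, ← hg] at h7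
        exact h7
      · apply conGenPair_le
        rw [hk, map_pow, hl]
    · left
      refine le_antisymm ?_ bot_le
      intro x y h
      refine ker_le_aux f ht _ ?_ x y ((hk x y).1 h)
      intro k γ hγ
      rcases k with _ | k
      · rw [pow_zero, ← map_one f, ← constE_one] at hγ
        rw [← hinj _ _ hγ, pow_zero, constE_one]
        exact Con.refl _ _
      · exact absurd ⟨k + 1, by omega, γ, hγ⟩ hex
end

section
/- A congruence c on M₀ := WithZero (Multiplicative ℕ) is a strong prime congruence if and only if c is the equality congruence ⊥, or c = conGen {(T, 0)}, or c = conGen {(T^n, 1)} for some natural number n ≥ 1. Moreover these congruences are pairwise distinct: ⊥, conGen {(T, 0)}, and conGen {(T^n, 1)} for distinct n ≥ 1 are all different. (This identifies the set of non-generic points of the strong congruence space of the affine chart of the projective line over F₁ with Smirnov's points [0] and [n], n ≥ 1.) -/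
open Multiplicative

/-- The pointed monoid `F₁[T]`, modeled as `WithZero (Multiplicative ℕ)`:
the nonzero element `ofAdd k` represents `T^k`. -/
abbrev M0 : Type := WithZero (Multiplicative ℕ)

/-- The element `T` of `F₁[T]`. -/
def T0 : M0 := ((ofAdd 1 : Multiplicative ℕ) : M0)

theorem M0_cases (x : M0) : x = 0 ∨ ∃ k : ℕ, x = T0 ^ k := by
  induction x using WithZero.recZeroCoe with
  | zero => exact Or.inl rfl
  | coe a =>
    right
    refine ⟨toAdd a, ?_⟩
    unfold T0
    rw [← WithZero.coe_pow, ← ofAdd_nsmul]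
    simp

theorem M0_ev {K : Type} [Field K] (a : K) : ∃ f : M0 →*₀ K, f T0 = a := by
  refine ⟨WithZero.lift' (powersHom K a), ?_⟩
  unfold T0
  rw [WithZero.lift'_coe]
  simp

theorem ker_rel {K : Type} [Field K] (f : M0 →*₀ K) (x y : M0) :
    Con.ker f.toMonoidHom x y ↔ f x = f y := Iff.rfl

theorem ker_zero {K : Type} [Field K] (f : M0 →*₀ K) (h : f T0 = 0) :
    Con.ker f.toMonoidHom = conGenPair T0 0 := by
  apply le_antisymm
  · have key : ∀ k : ℕ, conGenPair T0 0 (T0 ^ (k + 1)) 0 := fun k => by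
      have := (conGenPair T0 0).mul ((conGenPair T0 0).refl (T0 ^ k)) (conGenPair_rel T0 0)
      simpa [pow_succ] using this
    intro x y hxy
    rw [ker_rel] at hxy
    rcases M0_cases x with rfl | ⟨_ | k, rfl⟩ <;> rcases M0_cases y with rfl | ⟨_ | l, rfl⟩
    · exact Con.refl _ _
    · simp at hxy
    · exact Con.symm _ (key l)
    · simp at hxy
    · exact Con.refl _ _
    · simp [h] at hxy
    · exact key k
    · simp [h] at hxy
    · exact Con.trans _ (key k) (Con.symm _ (key l))
  · exact conGenPair_le (by rw [ker_rel, h, map_zero])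

theorem ker_ord {K : Type} [Field K] (f : M0 →*₀ K) (h : f T0 ≠ 0) :
    Con.ker f.toMonoidHom = conGenPair (T0 ^ orderOf (f T0)) 1 := by
  set n := orderOf (f T0) with hn
  apply le_antisymm
  · have key : ∀ k q : ℕ, conGenPair (T0 ^ n) 1 (T0 ^ (k + n * q)) (T0 ^ k) := fun k q => by
      have := (conGenPair (T0 ^ n) 1).mul ((conGenPair (T0 ^ n) 1).refl (T0 ^ k))
        ((conGenPair (T0 ^ n) 1).pow q (conGenPair_rel (T0 ^ n) 1))
      simpa [pow_add, pow_mul] using this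
    have key2 : ∀ k l : ℕ, k ≤ l → f T0 ^ k = f T0 ^ l →
        conGenPair (T0 ^ n) 1 (T0 ^ l) (T0 ^ k) := fun k l hkl e => by
      obtain ⟨d, rfl⟩ := Nat.exists_eq_add_of_le hkl
      rw [pow_add] at e
      have e1 : f T0 ^ d = 1 := (mul_eq_left₀ (pow_ne_zero k h)).1 e.symm
      obtain ⟨q, rfl⟩ := orderOf_dvd_of_pow_eq_one e1
      exact key k q
    intro x y hxy
    rw [ker_rel] at hxy
    rcases M0_cases x with rfl | ⟨k, rfl⟩ <;> rcases M0_cases y with rfl | ⟨l, rfl⟩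
    · exact Con.refl _ _
    · rw [map_zero, map_pow] at hxy
      exact absurd hxy.symm (pow_ne_zero _ h)
    · rw [map_zero, map_pow] at hxy
      exact absurd hxy (pow_ne_zero _ h)
    · rw [map_pow, map_pow] at hxy
      rcases le_total k l with hkl | hkl
      · exact Con.symm _ (key2 k l hkl hxy)
      · exact key2 l k hkl hxy.symm
  · exact conGenPair_le (by rw [ker_rel, map_pow, map_one, pow_orderOf_eq_one])

theorem conGenPair_self_bot {M : Type*} [Mul M] (a : M) : conGenPair a a = ⊥ :=
  le_bot_iff.1 (conGenPair_le (Con.refl _ _))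

theorem exists_ker (n : ℕ) : ∃ (K : Type) (_ : Field K), ∃ f : M0 →*₀ K,
    f T0 ≠ 0 ∧ orderOf (f T0) = n := by
  rcases Nat.eq_zero_or_pos n with rfl | hn
  · obtain ⟨f, hf⟩ := M0_ev (2 : ℚ)
    refine ⟨ℚ, inferInstance, f, by rw [hf]; norm_num, ?_⟩
    rw [hf, orderOf_eq_zero_iff']
    intro k hk e
    exact absurd e (one_lt_pow₀ (by norm_num) hk.ne').ne'
  · have hp := Complex.isPrimitiveRoot_exp n hn.ne'
    obtain ⟨f, hf⟩ := M0_ev (Complex.exp (2 * Real.pi * Complex.I / n))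
    refine ⟨ℂ, inferInstance, f, by rw [hf]; exact Complex.exp_ne_zero _, ?_⟩
    rw [hf]
    exact hp.eq_orderOf.symm

theorem conGenPair_dvd {n m : ℕ} (h : conGenPair (T0 ^ m) 1 (T0 ^ n) 1) : m ∣ n := by
  obtain ⟨K, _, f, h0, rfl⟩ := exists_ker m
  rw [← ker_ord f h0, ker_rel, map_pow, map_one] at h
  exact orderOf_dvd_of_pow_eq_one h

theorem not_conGenPair_zero (m : ℕ) : ¬ conGenPair (T0 ^ m) 1 T0 0 := by
  intro h
  obtain ⟨K, _, f, h0, rfl⟩ := exists_ker m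
  rw [← ker_ord f h0, ker_rel, map_zero] at h
  exact h0 h

theorem conGenPair_zero_bot : conGenPair (T0 ^ 0) 1 = ⊥ := by
  rw [pow_zero, conGenPair_self_bot]

/-- a congruence on `F₁[T]` is a strong prime congruence iff it is `⊥`,
`⟨T ~ 0⟩`, or `⟨T^n ~ 1⟩` for some `n ≥ 1`; moreover these congruences are pairwise
distinct. -/
theorem strongPrimeCon_M0_classification :
    (∀ c : Con M0, IsStrongPrimeCon c ↔
      (c = ⊥ ∨ c = conGenPair T0 0 ∨ ∃ n : ℕ, 1 ≤ n ∧ c = conGenPair (T0 ^ n) 1)) ∧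
    conGenPair T0 0 ≠ ⊥ ∧
    (∀ n : ℕ, 1 ≤ n →
      conGenPair (T0 ^ n) 1 ≠ ⊥ ∧ conGenPair (T0 ^ n) 1 ≠ conGenPair T0 0) ∧
    (∀ n m : ℕ, 1 ≤ n → 1 ≤ m → conGenPair (T0 ^ n) 1 = conGenPair (T0 ^ m) 1 → n = m) := by
  refine ⟨fun c => ⟨?_, ?_⟩, ?_, fun n hn => ⟨?_, ?_⟩, ?_⟩
  · rintro ⟨K, _, f, rfl⟩
    by_cases h : f T0 = 0
    · exact Or.inr (Or.inl (ker_zero f h))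
    · rcases Nat.eq_zero_or_pos (orderOf (f T0)) with h0 | h0
      · left
        rw [ker_ord f h, h0, conGenPair_zero_bot]
      · exact Or.inr (Or.inr ⟨_, h0, ker_ord f h⟩)
  · rintro (rfl | rfl | ⟨n, hn, rfl⟩)
    · obtain ⟨K, i, f, h0, h⟩ := exists_ker 0
      exact ⟨K, i, f, by rw [ker_ord f h0, h, conGenPair_zero_bot]⟩
    · obtain ⟨f, hf⟩ := M0_ev (0 : ℚ)
      exact ⟨ℚ, inferInstance, f, ker_zero f hf⟩
    · obtain ⟨K, i, f, h0, h⟩ := exists_ker n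
      exact ⟨K, i, f, by rw [ker_ord f h0, h]⟩
  · intro h
    apply not_conGenPair_zero 0
    rw [conGenPair_zero_bot, ← h]
    exact conGenPair_rel _ _
  · intro h
    have h1 := conGenPair_rel (T0 ^ n) 1
    rw [h, ← conGenPair_zero_bot] at h1
    have := Nat.eq_zero_of_zero_dvd (conGenPair_dvd h1)
    omega
  · intro h
    apply not_conGenPair_zero n
    rw [h]
    exact conGenPair_rel _ _
  · intro n m _ _ h
    apply Nat.dvd_antisymm
    · apply conGenPair_dvd
      rw [h]
      exact conGenPair_rel _ _
    · apply conGenPair_dvd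
      rw [← h]
      exact conGenPair_rel _ _
end

section
/- Let H be the subgroup of ℂˣ consisting of all roots of unity (all elements of finite order). A congruence c on M(H) is an H-congruence if and only if c is the equality congruence ⊥, or c = conGen {(T, 0)}, or c = conGen {(T, ζ)} for some ζ ∈ H. Moreover the map ζ ↦ conGen {(T, ζ)} is injective on H, and its values are distinct from ⊥ and from conGen {(T, 0)}. (This identifies the set of non-generic points of the strong congruence space of the affine chart of the projective line over F_{1^∞} with Smirnov's geometric points.) -/
open Multiplicative

/-- The subgroup of `ℂˣ` consisting of all roots of unity (all elements of finite order). -/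
def Hsub : Subgroup ℂˣ := CommGroup.torsion ℂˣ

namespace GammaAux

variable {Γ : Subgroup ℂˣ}

theorem coe_eq (γ : Γ) (k : Multiplicative ℕ) :
    (((γ, k) : Γ × Multiplicative ℕ) : MGamma Γ) = constE γ * Tgen Γ ^ (toAdd k) := by
  unfold constE Tgen
  rw [← WithZero.coe_pow, ← WithZero.coe_mul]
  congr 1
  ext
  · simp
  · simp [← ofAdd_nsmul]

theorem elim (x : MGamma Γ) : x = 0 ∨ ∃ (γ : Γ) (k : ℕ), x = constE γ * Tgen Γ ^ k := by
  induction x using WithZero.recZeroCoe with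
  | zero => exact Or.inl rfl
  | coe a => exact Or.inr ⟨a.1, toAdd a.2, coe_eq a.1 a.2⟩

theorem constE_mul (γ δ : Γ) : constE (γ * δ) = constE γ * constE δ := by
  unfold constE
  rw [← WithZero.coe_mul]
  rfl

theorem constE_one : constE (1 : Γ) = 1 := rfl

/-- The constants as a monoid homomorphism. -/
noncomputable def constHom : Γ →* MGamma Γ where
  toFun := constE
  map_one' := constE_one
  map_mul' := constE_mul

theorem constE_pow (γ : Γ) (n : ℕ) : constE (γ ^ n) = constE γ ^ n :=
  map_pow constHom γ n

theorem pair_rel {M : Type*} [Mul M] (a b : M) : conGenPair a b a b :=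
  ConGen.Rel.of _ _ ⟨rfl, rfl⟩

theorem pair_le {M : Type*} [Mul M] {a b : M} {c : Con M} (h : c a b) : conGenPair a b ≤ c := by
  refine Con.conGen_le.2 ?_
  rintro x y ⟨rfl, rfl⟩
  exact h

/-- Evaluation `T ↦ t`. -/
noncomputable def ev (t : ℂ) : MGamma Γ →*₀ ℂ :=
  WithZero.lift' (MonoidHom.coprod ((Units.coeHom ℂ).comp Γ.subtype) (powersHom ℂ t))

theorem ev_const (t : ℂ) (γ : Γ) : ev t (constE γ) = ((γ : ℂˣ) : ℂ) := by
  simp [ev, constE]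

theorem ev_T (t : ℂ) : ev t (Tgen Γ) = t := by
  simp [ev, Tgen]

section field
variable {K : Type} [Field K] (f : MGamma Γ →*₀ K)

theorem f_const_ne (γ : Γ) : f (constE γ) ≠ 0 := by
  intro h
  have : f (constE (γ * γ⁻¹)) = 0 := by rw [constE_mul, map_mul, h, zero_mul]
  rw [mul_inv_cancel, constE_one, map_one] at this
  exact one_ne_zero this

theorem ker_apply (x y : MGamma Γ) : Con.ker f.toMonoidHom x y ↔ f x = f y := Iff.rfl

/-- A retraction onto representatives determines the kernel. -/
theorem ker_zero (hinj : ∀ γ δ : Γ, f (constE γ) = f (constE δ) → γ = δ)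
    (hT : f (Tgen Γ) = 0) : Con.ker f.toMonoidHom = conGenPair (Tgen Γ) 0 := by
  have hle : conGenPair (Tgen Γ) 0 ≤ Con.ker f.toMonoidHom :=
    pair_le (by rw [ker_apply, hT, map_zero])
  refine le_antisymm ?_ hle
  have key : ∀ x : MGamma Γ, conGenPair (Tgen Γ) 0 x 0 ∨ ∃ γ, x = constE γ := by
    intro x
    rcases elim x with rfl | ⟨γ, k, rfl⟩
    · exact Or.inl (Con.refl _ _)
    · rcases k with _ | k
      · exact Or.inr ⟨γ, by simp⟩
      · left
        have := Con.mul _ (Con.refl _ (constE γ * Tgen Γ ^ k)) (pair_rel (Tgen Γ) 0)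
        rwa [mul_zero, mul_assoc, ← pow_succ] at this
  intro x y hxy
  rw [ker_apply] at hxy
  rcases key x with hx | ⟨γ, rfl⟩ <;> rcases key y with hy | ⟨δ, rfl⟩
  · exact Con.trans _ hx (Con.symm _ hy)
  · have h := hle hx
    rw [ker_apply, map_zero] at h
    exact absurd (hxy.symm.trans h) (f_const_ne f δ)
  · have h := hle hy
    rw [ker_apply, map_zero] at h
    exact absurd (hxy.trans h) (f_const_ne f γ)
  · rw [hinj _ _ hxy]
    exact Con.refl _ _

theorem ker_const (hinj : ∀ γ δ : Γ, f (constE γ) = f (constE δ) → γ = δ) (ζ : Γ)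
    (hT : f (Tgen Γ) = f (constE ζ)) :
    Con.ker f.toMonoidHom = conGenPair (Tgen Γ) (constE ζ) := by
  have hle : conGenPair (Tgen Γ) (constE ζ) ≤ Con.ker f.toMonoidHom :=
    pair_le (by rw [ker_apply, hT])
  refine le_antisymm ?_ hle
  have key : ∀ x : MGamma Γ, x = 0 ∨ ∃ γ, conGenPair (Tgen Γ) (constE ζ) x (constE γ) := by
    intro x
    rcases elim x with rfl | ⟨γ, k, rfl⟩
    · exact Or.inl rfl
    · right
      refine ⟨γ * ζ ^ k, ?_⟩
      rw [constE_mul, constE_pow]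
      exact Con.mul _ (Con.refl _ _) (Con.pow _ k (pair_rel _ _))
  intro x y hxy
  rw [ker_apply] at hxy
  rcases key x with rfl | ⟨γ, hx⟩ <;> rcases key y with rfl | ⟨δ, hy⟩
  · exact Con.refl _ _
  · have h := hle hy
    rw [ker_apply, ← hxy, map_zero] at h
    exact absurd h.symm (f_const_ne f δ)
  · have h := hle hx
    rw [ker_apply, hxy, map_zero] at h
    exact absurd h.symm (f_const_ne f γ)
  · have h1 := hle hx
    have h2 := hle hy
    rw [ker_apply] at h1 h2
    have : γ = δ := hinj _ _ (h1.symm.trans (hxy.trans h2))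
    subst this
    exact Con.trans _ hx (Con.symm _ hy)

/-- If no nontrivial power of `f T` is a constant, the kernel is trivial. -/
theorem ker_bot (hinj : ∀ γ δ : Γ, f (constE γ) = f (constE δ) → γ = δ)
    (h0 : f (Tgen Γ) ≠ 0)
    (hT : ∀ n : ℕ, 0 < n → ∀ γ : Γ, f (Tgen Γ) ^ n ≠ f (constE γ)) :
    Con.ker f.toMonoidHom = ⊥ := by
  have hlt : ∀ (γ δ : Γ) (k l : ℕ), k < l →
      f (constE γ) * f (Tgen Γ) ^ k ≠ f (constE δ) * f (Tgen Γ) ^ l := by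
    intro γ δ k l hkl h
    obtain ⟨n, rfl⟩ := Nat.exists_eq_add_of_lt hkl
    apply hT (n + 1) (Nat.succ_pos _) (δ⁻¹ * γ)
    have hd := f_const_ne f δ
    have hdi : f (constE δ⁻¹) * f (constE δ) = 1 := by
      rw [← map_mul, ← constE_mul, inv_mul_cancel, constE_one, map_one]
    rw [add_assoc, pow_add, mul_left_comm, mul_comm] at h
    have h2 := mul_left_cancel₀ (pow_ne_zero k h0) h
    rw [constE_mul, map_mul, h2, ← mul_assoc, hdi, one_mul]
  refine le_antisymm ?_ bot_le
  intro x y hxy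
  rw [ker_apply] at hxy
  change x = y
  rcases elim x with rfl | ⟨γ, k, rfl⟩ <;> rcases elim y with rfl | ⟨δ, l, rfl⟩
  · rfl
  · rw [map_zero, map_mul, map_pow] at hxy
    exact absurd hxy.symm (mul_ne_zero (f_const_ne f δ) (pow_ne_zero _ h0))
  · rw [map_zero, map_mul, map_pow] at hxy
    exact absurd hxy (mul_ne_zero (f_const_ne f γ) (pow_ne_zero _ h0))
  · simp only [map_mul, map_pow] at hxy
    rcases lt_trichotomy k l with h | rfl | h
    · exact absurd hxy (hlt _ _ _ _ h)
    · rw [hinj _ _ (mul_right_cancel₀ (pow_ne_zero k h0) hxy)]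
    · exact absurd hxy.symm (hlt _ _ _ _ h)

end field

theorem ev_inj (t : ℂ) (γ δ : Γ) (h : ev t (constE γ) = ev t (constE δ)) : γ = δ := by
  rw [ev_const, ev_const] at h
  exact Subtype.ext (Units.ext h)

theorem ev_gamma (t : ℂ) : IsGammaCon Γ (Con.ker (ev (Γ := Γ) t).toMonoidHom) :=
  ⟨⟨ℂ, inferInstance, ev t, rfl⟩, fun γ δ h => ev_inj t γ δ h⟩

theorem zero_eq : Con.ker (ev (Γ := Γ) 0).toMonoidHom = conGenPair (Tgen Γ) 0 :=
  ker_zero _ (ev_inj 0) (ev_T 0)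

theorem const_eq (ζ : Γ) : Con.ker (ev (Γ := Γ) ((ζ : ℂˣ) : ℂ)).toMonoidHom =
    conGenPair (Tgen Γ) (constE ζ) :=
  ker_const _ (ev_inj _) ζ (by rw [ev_T, ev_const])

theorem norm_Hsub (γ : Hsub) : ‖((γ : ℂˣ) : ℂ)‖ = 1 := by
  obtain ⟨n, hn, h⟩ := isOfFinOrder_iff_pow_eq_one.1 (show IsOfFinOrder (γ : ℂˣ) from γ.2)
  refine Complex.norm_eq_one_of_pow_eq_one (n := n) ?_ hn.ne'
  rw [← Units.val_pow_eq_pow_val, h, Units.val_one]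

theorem bot_eq : Con.ker (ev (Γ := Hsub) 2).toMonoidHom = ⊥ := by
  refine ker_bot _ (ev_inj _) (by rw [ev_T]; norm_num) ?_
  intro n hn γ h
  rw [ev_T, ev_const] at h
  have h2 := congrArg norm h
  rw [norm_Hsub, norm_pow] at h2
  have : (1 : ℝ) < ‖(2 : ℂ)‖ ^ n := one_lt_pow₀ (by norm_num) hn.ne'
  linarith

/-- In `Hsub` every element has an `n`-th root. -/
theorem exists_root (n : ℕ) (hn : 0 < n) (γ : Hsub) : ∃ η : Hsub, η ^ n = γ := by
  obtain ⟨z, hz⟩ := IsAlgClosed.exists_pow_nat_eq ((γ : ℂˣ) : ℂ) hn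
  have hz0 : z ≠ 0 := by
    rintro rfl
    rw [zero_pow hn.ne'] at hz
    exact (γ : ℂˣ).ne_zero hz.symm
  have hu : (Units.mk0 z hz0) ^ n = (γ : ℂˣ) := Units.ext (by simpa using hz)
  refine ⟨⟨Units.mk0 z hz0, ?_⟩, Subtype.ext hu⟩
  have h1 : IsOfFinOrder (γ : ℂˣ) := γ.2
  rw [← hu] at h1
  exact h1.of_pow hn.ne'

theorem exists_prim (n : ℕ) (hn : 0 < n) : ∃ η : Hsub, IsPrimitiveRoot η n := by
  have h := Complex.isPrimitiveRoot_exp n hn.ne'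
  obtain ⟨u, hu⟩ := h.isUnit hn.ne'
  rw [← hu, IsPrimitiveRoot.coe_units_iff] at h
  have hm : u ∈ Hsub := isOfFinOrder_iff_pow_eq_one.2 ⟨n, hn, h.pow_eq_one⟩
  exact ⟨⟨u, hm⟩, IsPrimitiveRoot.coe_submonoidClass_iff.1 h⟩

theorem root_const {K : Type} [Field K] (f : MGamma Hsub →*₀ K)
    (hinj : ∀ γ δ : Hsub, f (constE γ) = f (constE δ) → γ = δ)
    (n : ℕ) (hn : 0 < n) (γ : Hsub) (h : f (Tgen Hsub) ^ n = f (constE γ)) :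
    ∃ ζ : Hsub, f (Tgen Hsub) = f (constE ζ) := by
  obtain ⟨η, hη⟩ := exists_root n hn γ
  obtain ⟨ω, hω⟩ := exists_prim n hn
  have hω2 : IsPrimitiveRoot (f (constE ω)) n :=
    hω.map_of_injective (f := f.toMonoidHom.comp constHom) (fun a b hab => hinj a b hab)
  have : NeZero n := ⟨hn.ne'⟩
  have hq : (f (Tgen Hsub) / f (constE η)) ^ n = 1 := by
    rw [div_pow, h, ← map_pow, ← constE_pow, hη, div_self (f_const_ne f γ)]
  obtain ⟨i, -, hi⟩ := hω2.eq_pow_of_pow_eq_one hq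
  refine ⟨ω ^ i * η, ?_⟩
  rw [constE_mul, constE_pow, map_mul, map_pow, hi, div_mul_cancel₀ _ (f_const_ne f η)]

end GammaAux

open GammaAux

/-- a congruence `c` on `F_{1^∞}[T]` is an `H`-congruence iff it is `⊥`,
`⟨T ~ 0⟩`, or `⟨T ~ ζ⟩` for some root of unity `ζ`; moreover `ζ ↦ ⟨T ~ ζ⟩` is injective
and its values differ from `⊥` and `⟨T ~ 0⟩`. -/
theorem gammaCon_Hsub_classification :
    (∀ c : Con (MGamma Hsub), IsGammaCon Hsub c ↔
      (c = ⊥ ∨ c = conGenPair (Tgen Hsub) 0 ∨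
        ∃ ζ : Hsub, c = conGenPair (Tgen Hsub) (constE ζ))) ∧
    Function.Injective (fun ζ : Hsub => conGenPair (Tgen Hsub) (constE ζ)) ∧
    (∀ ζ : Hsub, conGenPair (Tgen Hsub) (constE ζ) ≠ ⊥ ∧
      conGenPair (Tgen Hsub) (constE ζ) ≠ conGenPair (Tgen Hsub) 0) := by
  refine ⟨fun c => ⟨?_, ?_⟩, ?_, fun ζ => ⟨?_, ?_⟩⟩
  · rintro ⟨⟨K, _, f, rfl⟩, hinj⟩
    replace hinj : ∀ γ δ : Hsub, f (constE γ) = f (constE δ) → γ = δ := hinj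
    by_cases h0 : f (Tgen Hsub) = 0
    · exact Or.inr (Or.inl (ker_zero f hinj h0))
    by_cases hT : ∃ ζ : Hsub, f (Tgen Hsub) = f (constE ζ)
    · obtain ⟨ζ, hζ⟩ := hT
      exact Or.inr (Or.inr ⟨ζ, ker_const f hinj ζ hζ⟩)
    · exact Or.inl (ker_bot f hinj h0 fun n hn γ h => hT (root_const f hinj n hn γ h))
  · rintro (rfl | rfl | ⟨ζ, rfl⟩)
    · rw [← bot_eq]
      exact ev_gamma 2
    · rw [← zero_eq]
      exact ev_gamma 0
    · rw [← const_eq]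
      exact ev_gamma _
  · intro ζ ξ h
    have h1 : conGenPair (Tgen Hsub) (constE ζ) (Tgen Hsub) (constE ξ) := by
      rw [show conGenPair (Tgen Hsub) (constE ζ) = conGenPair (Tgen Hsub) (constE ξ) from h]
      exact pair_rel _ _
    rw [← const_eq, ker_apply, ev_T, ev_const] at h1
    exact Subtype.ext (Units.ext h1)
  · intro h
    have h1 := pair_rel (Tgen Hsub) (constE ζ)
    rw [h, ← bot_eq, ker_apply, ev_T, ev_const] at h1
    have h2 := congrArg norm h1
    rw [norm_Hsub] at h2
    norm_num at h2
  · intro h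
    have h1 := pair_rel (Tgen Hsub) (constE ζ)
    rw [h, ← zero_eq, ker_apply, ev_T, ev_const] at h1
    exact (ζ : ℂˣ).ne_zero h1.symm
end

section
/- Let H be the subgroup of ℂˣ of all roots of unity, Γ a subgroup of H, and ζ ∈ H. Let n ≥ 1 be minimal with ζ^n ∈ Γ (such n exists since ζ has finite order), and set λ := ζ^n ∈ Γ. Let ι : M(Γ) →*₀ M(H) be the monoid-with-zero homomorphism induced by the inclusion Γ ↪ H and the identity on exponents. Then the pullback along ι of the congruence conGen {(T, ζ)} on M(H) (the congruence relating x, y ∈ M(Γ) iff conGen {(T, ζ)} relates ι x and ι y) equals the congruence conGen {(T^n, λ)} on M(Γ). (This computes the fibers of the map Φ_Γ from the strong congruence space of the projective line over F_{1^∞} to that over F_Γ.) -/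
open Multiplicative

/-- for a subgroup `Γ` of the roots of unity `H`, a root of unity `ζ`, and the
minimal `n ≥ 1` with `ζ^n ∈ Γ` (with `λ := ζ^n`), the pullback along the induced map
`ι : Γ[T] →*₀ H[T]` of the congruence `⟨T ~ ζ⟩` equals `⟨T^n ~ λ⟩`. -/
theorem comap_conGenPair_T_zeta (Γ : Subgroup ℂˣ) (hΓ : Γ ≤ Hsub) (ζ : Hsub)
    (n : ℕ) (hn : 1 ≤ n) (hζn : (ζ : ℂˣ) ^ n ∈ Γ)
    (hmin : ∀ w : ℕ, 1 ≤ w → w < n → (ζ : ℂˣ) ^ w ∉ Γ)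
    (ι : MGamma Γ →*₀ MGamma Hsub)
    (hι : ∀ (γ : Γ) (k : Multiplicative ℕ),
      ι (((γ, k) : Γ × Multiplicative ℕ) : MGamma Γ)
        = (((⟨(γ : ℂˣ), hΓ γ.2⟩ : Hsub), k) : Hsub × Multiplicative ℕ)) :
    Con.comap ι (map_mul ι) (conGenPair (Tgen Hsub) (constE ζ)) =
      conGenPair (Tgen Γ ^ n) (constE (⟨(ζ : ℂˣ) ^ n, hζn⟩ : Γ)) := by
  classical
  set lam : Γ := ⟨(ζ : ℂˣ) ^ n, hζn⟩ with hlam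
  apply le_antisymm
  · -- the evaluation `T ↦ ζ`
    let φ : MGamma Hsub →*₀ WithZero Hsub :=
      WithZero.map' (MonoidHom.coprod (MonoidHom.id Hsub) (powersHom Hsub ζ))
    have hφ : ∀ (h : Hsub) (k : ℕ),
        φ (((h, ofAdd k) : Hsub × Multiplicative ℕ) : MGamma Hsub)
          = ((h * ζ ^ k : Hsub) : WithZero Hsub) := by
      intro h k
      simp [φ, WithZero.map'_coe]
    have hle : conGenPair (Tgen Hsub) (constE ζ) ≤ Con.ker φ.toMonoidHom := by
      refine Con.conGen_le.2 ?_
      rintro x y ⟨rfl, rfl⟩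
      change φ (Tgen Hsub) = φ (constE ζ)
      rw [Tgen, constE, hφ, hφ]
      simp
    have key : ∀ (γ δ : Γ) (k l : ℕ), k ≤ l → (γ : ℂˣ) * (ζ : ℂˣ) ^ k = δ * (ζ : ℂˣ) ^ l →
        conGenPair (Tgen Γ ^ n) (constE lam)
          (((δ, ofAdd l) : Γ × Multiplicative ℕ) : MGamma Γ)
          (((γ, ofAdd k) : Γ × Multiplicative ℕ) : MGamma Γ) := by
      intro γ δ k l hkl h
      obtain ⟨d, rfl⟩ := Nat.exists_eq_add_of_le hkl
      have h1 : (γ : ℂˣ) = δ * (ζ : ℂˣ) ^ d := by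
        have : (γ : ℂˣ) * (ζ : ℂˣ) ^ k = (δ * (ζ : ℂˣ) ^ d) * (ζ : ℂˣ) ^ k := by
          rw [h, pow_add, mul_assoc, mul_comm ((ζ : ℂˣ) ^ k)]
        exact mul_right_cancel this
      have h2 : (ζ : ℂˣ) ^ d ∈ Γ := by
        have : (ζ : ℂˣ) ^ d = (δ : ℂˣ)⁻¹ * γ := by rw [h1]; simp
        rw [this]
        exact Γ.mul_mem (Γ.inv_mem δ.2) γ.2
      have h3 : (ζ : ℂˣ) ^ (d % n) ∈ Γ := by
        have e : (ζ : ℂˣ) ^ d = ((ζ : ℂˣ) ^ n) ^ (d / n) * (ζ : ℂˣ) ^ (d % n) := by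
          rw [← pow_mul, ← pow_add, Nat.div_add_mod]
        rw [e] at h2
        exact (Γ.mul_mem_cancel_left (Γ.pow_mem hζn _)).1 h2
      have h4 : d % n = 0 := by
        by_contra h0
        exact hmin _ (Nat.one_le_iff_ne_zero.2 h0) (Nat.mod_lt _ hn) h3
      obtain ⟨m, rfl⟩ := Nat.dvd_of_mod_eq_zero h4
      have h5 : γ = δ * lam ^ m := by
        apply Subtype.ext
        rw [h1, pow_mul]
        rfl
      have base : conGenPair (Tgen Γ ^ n) (constE lam) (Tgen Γ ^ n) (constE lam) :=
        ConGen.Rel.of _ _ ⟨rfl, rfl⟩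
      have r := (conGenPair (Tgen Γ ^ n) (constE lam)).mul
        ((conGenPair (Tgen Γ ^ n) (constE lam)).refl
          (((δ, ofAdd k) : Γ × Multiplicative ℕ) : MGamma Γ))
        ((conGenPair (Tgen Γ ^ n) (constE lam)).pow m base)
      have e1 : (((δ, ofAdd k) : Γ × Multiplicative ℕ) : MGamma Γ) * (Tgen Γ ^ n) ^ m
          = (((δ, ofAdd (k + n * m)) : Γ × Multiplicative ℕ) : MGamma Γ) := by
        rw [Tgen, ← WithZero.coe_pow, ← WithZero.coe_pow, ← WithZero.coe_mul]
        congr 1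
        ext1
        · simp
        · change ofAdd k * ((ofAdd 1) ^ n) ^ m = ofAdd (k + n * m)
          rw [← pow_mul, ← ofAdd_nsmul, ← ofAdd_add, smul_eq_mul, mul_one]
      have e2 : (((δ, ofAdd k) : Γ × Multiplicative ℕ) : MGamma Γ) * (constE lam) ^ m
          = (((γ, ofAdd k) : Γ × Multiplicative ℕ) : MGamma Γ) := by
        rw [constE, ← WithZero.coe_pow, ← WithZero.coe_mul, h5]
        simp
      rw [e1, e2] at r
      exact r
    intro x y hxy
    have hxy' : φ (ι x) = φ (ι y) := hle hxy
    induction x using WithZero.recZeroCoe with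
    | zero =>
      induction y using WithZero.recZeroCoe with
      | zero => exact Con.refl _ _
      | coe b =>
        obtain ⟨δ, l⟩ := b
        rw [hι, ← ofAdd_toAdd l, hφ] at hxy'
        simp at hxy'
    | coe a =>
      obtain ⟨γ, k⟩ := a
      induction y using WithZero.recZeroCoe with
      | zero =>
        rw [hι, ← ofAdd_toAdd k, hφ] at hxy'
        simp at hxy'
      | coe b =>
        obtain ⟨δ, l⟩ := b
        rw [hι, hι, ← ofAdd_toAdd k, ← ofAdd_toAdd l, hφ, hφ, WithZero.coe_inj] at hxy'
        have h := congrArg (Subtype.val) hxy'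
        rcases le_total (toAdd k) (toAdd l) with hkl | hkl
        · exact Con.symm _ (key γ δ (toAdd k) (toAdd l) hkl h)
        · exact key δ γ (toAdd l) (toAdd k) hkl h.symm
  · refine Con.conGen_le.2 ?_
    rintro x y ⟨rfl, rfl⟩
    change conGenPair (Tgen Hsub) (constE ζ) (ι _) (ι _)
    have base : conGenPair (Tgen Hsub) (constE ζ) (Tgen Hsub) (constE ζ) :=
      ConGen.Rel.of _ _ ⟨rfl, rfl⟩
    have r := (conGenPair (Tgen Hsub) (constE ζ)).pow n base
    have e1 : ι (Tgen Γ ^ n) = Tgen Hsub ^ n := by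
      rw [map_pow, Tgen, hι]
      rfl
    have e2 : ι (constE lam) = constE ζ ^ n := by
      rw [constE, hι, constE, ← WithZero.coe_pow]
      congr 1
    rw [e1, e2]
    exact r
end

section
/- Let Γ be a subgroup of ℂˣ all of whose elements have finite order, let λ ∈ Γ have multiplicative order h, and let m ≥ 1. Let ι : M₀ →*₀ M(Γ) be the monoid-with-zero homomorphism sending the nonzero element ofAdd k to (1, ofAdd k). Then the pullback along ι of the congruence conGen {(T^m, λ)} on M(Γ) equals the congruence conGen {(T^{m·h}, 1)} on M₀. (This computes the fibers of the map Ψ_Γ from the strong congruence space of the projective line over F_Γ to that over F₁: the point [m, λ] maps to [m·ord(λ)].) -/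
open Multiplicative

/-- for `λ ∈ Γ` of multiplicative order `h` and `m ≥ 1`, the pullback along
`ι : F₁[T] →*₀ Γ[T]`, `T^k ↦ (1, T^k)`, of the congruence `⟨T^m ~ λ⟩` on `Γ[T]` equals the
congruence `⟨T^{m·h} ~ 1⟩` on `F₁[T]`. -/
theorem comap_conGenPair_Tm_lambda (Γ : Subgroup ℂˣ) (hΓ : ∀ γ : Γ, IsOfFinOrder γ)
    (l : Γ) (h : ℕ) (hh : orderOf l = h) (m : ℕ) (hm : 1 ≤ m)
    (ι : M0 →*₀ MGamma Γ)
    (hι : ∀ k : Multiplicative ℕ,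
      ι ((k : Multiplicative ℕ) : M0) = ((((1 : Γ), k) : Γ × Multiplicative ℕ) : MGamma Γ)) :
    Con.comap ι (map_mul ι) (conGenPair (Tgen Γ ^ m) (constE l)) =
      conGenPair (T0 ^ (m * h)) 1 := by
  have key : ∀ i k : ℕ, conGenPair (T0 ^ (m * h)) (1 : M0) (T0 ^ i) (T0 ^ (i + m * h * k)) := by
    intro i k
    have h1 : conGenPair (T0 ^ (m * h)) (1 : M0) (T0 ^ (m * h)) 1 :=
      Con.le_conGen _ _ ⟨rfl, rfl⟩
    have h2 := Con.pow _ k h1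
    have h3 := Con.mul _ (Con.refl _ (T0 ^ i)) h2
    rw [one_pow, mul_one, ← pow_mul, ← pow_add] at h3
    exact Con.symm _ h3
  have hT : ∀ k : ℕ, ((ofAdd k : Multiplicative ℕ) : M0) = T0 ^ k := by
    intro k
    rw [T0, ← WithZero.coe_pow, ← ofAdd_nsmul]
    simp
  have hTg : ∀ k : ℕ, Tgen Γ ^ k = ((((1 : Γ), ofAdd k) : Γ × Multiplicative ℕ) : MGamma Γ) := by
    intro k
    rw [Tgen, ← WithZero.coe_pow, Prod.pow_mk, ← ofAdd_nsmul]
    simp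
  apply le_antisymm
  · let g : Γ × Multiplicative ℕ →* Γ × Multiplicative ℤ :=
      MonoidHom.prodMap (MonoidHom.id Γ) (AddMonoidHom.toMultiplicative (Nat.castAddMonoidHom ℤ))
    let N : Subgroup (Γ × Multiplicative ℤ) := Subgroup.zpowers (l⁻¹, ofAdd (m : ℤ))
    let q : Γ × Multiplicative ℕ →* (Γ × Multiplicative ℤ) ⧸ N := (QuotientGroup.mk' N).comp g
    let f : MGamma Γ →*₀ WithZero ((Γ × Multiplicative ℤ) ⧸ N) := WithZero.map' q
    have hle : conGenPair (Tgen Γ ^ m) (constE l) ≤ Con.ker f.toMonoidHom := by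
      refine Con.conGen_le.2 ?_
      rintro x y ⟨rfl, rfl⟩
      refine (Con.ker_rel _).2 ?_
      change f (Tgen Γ ^ m) = f (constE l)
      rw [hTg, constE]
      change WithZero.map' q _ = WithZero.map' q _
      rw [WithZero.map'_coe, WithZero.map'_coe]
      congr 1
      refine (QuotientGroup.eq.2 ?_ : ((g (l, ofAdd 0) : Γ × Multiplicative ℤ) : (Γ × Multiplicative ℤ) ⧸ N) = (g (1, ofAdd m) : Γ × Multiplicative ℤ)).symm
      refine Subgroup.mem_zpowers_iff.2 ⟨1, ?_⟩
      ext <;> simp [g]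
    have hq : ∀ i j : ℕ, q (1, ofAdd i) = q (1, ofAdd j) → ∃ n : ℤ, (j : ℤ) = i + m * h * n := by
      intro i j hij
      have h1 : (g (1, ofAdd i))⁻¹ * g (1, ofAdd j) ∈ N := QuotientGroup.eq.1 hij
      obtain ⟨n, hn⟩ := Subgroup.mem_zpowers_iff.1 h1
      have e1 : l ^ n = 1 := by
        have := congrArg Prod.fst hn
        simpa [g] using this
      have e2 : n * (m : ℤ) = -(i : ℤ) + j := by
        have := congrArg (fun z => toAdd (Prod.snd z)) hn
        simpa [g] using this
      obtain ⟨t, rfl⟩ := orderOf_dvd_iff_zpow_eq_one.2 e1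
      rw [hh] at e2
      exact ⟨t, by linarith⟩
    intro x y hxy
    have hxy' : f (ι x) = f (ι y) := hle hxy
    induction x using WithZero.recZeroCoe with
    | zero =>
      induction y using WithZero.recZeroCoe with
      | zero => exact Con.refl _ _
      | coe b =>
        rw [hι, map_zero, map_zero] at hxy'
        exact absurd hxy'.symm WithZero.coe_ne_zero
    | coe a =>
      induction y using WithZero.recZeroCoe with
      | zero =>
        rw [hι, map_zero, map_zero] at hxy'
        exact absurd hxy' WithZero.coe_ne_zero
      | coe b =>
        rw [hι, hι] at hxy'
        obtain ⟨n, hn⟩ := hq (toAdd a) (toAdd b) (WithZero.coe_injective hxy')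
        have ha := hT (toAdd a)
        have hb := hT (toAdd b)
        rw [ofAdd_toAdd] at ha hb
        rw [ha, hb]
        obtain ⟨k, rfl | rfl⟩ := n.eq_nat_or_neg
        · have : toAdd b = toAdd a + m * h * k := by exact_mod_cast hn
          rw [this]
          exact key _ _
        · have : toAdd a = toAdd b + m * h * k := by
            zify
            linarith
          rw [this]
          exact Con.symm _ (key _ _)
  · refine Con.conGen_le.2 ?_
    rintro x y ⟨rfl, rfl⟩
    change conGenPair (Tgen Γ ^ m) (constE l) (ι _) (ι 1)
    have h1 : conGenPair (Tgen Γ ^ m) (constE l) (Tgen Γ ^ m) (constE l) :=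
      Con.le_conGen _ _ ⟨rfl, rfl⟩
    have h2 := Con.pow _ h h1
    have h3 : (constE l) ^ h = (1 : MGamma Γ) := by
      rw [constE, ← WithZero.coe_pow, Prod.pow_mk, ← hh, pow_orderOf_eq_one]
      simp
      rfl
    rw [h3, ← pow_mul, hTg (m * h)] at h2
    rw [← hT, hι, map_one]
    exact h2
end

section
/- Let Γ be a subgroup of ℂˣ all of whose elements have finite order, let λ ∈ Γ, and let n ≥ 1 be such that there is no divisor d > 1 of n and no θ ∈ Γ with θ^d = λ. Then every ζ ∈ ℂ with ζ^n = λ satisfies: ζ is a root of unity (has finite multiplicative order), ζ^n ∈ Γ, and for every w with 1 ≤ w < n one has ζ^w ∉ Γ (i.e. no element of Γ equals ζ^w). In particular n is the minimal positive exponent w with ζ^w ∈ Γ, which shows that the map Φ_Γ is surjective onto the points [n, λ]. -/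
/-- let `Γ` be a subgroup of `ℂˣ` all of whose elements have finite order,
`λ ∈ Γ`, and `n ≥ 1` such that no divisor `d > 1` of `n` admits a `d`-th root `θ ∈ Γ` of `λ`.
Then every `ζ ∈ ℂ` with `ζ^n = λ` is a root of unity, satisfies `ζ^n ∈ Γ`, and `ζ^w ∉ Γ`
for all `1 ≤ w < n`; so `n` is the minimal positive exponent `w` with `ζ^w ∈ Γ`. -/
theorem root_min_exponent (Γ : Subgroup ℂˣ) (hΓ : ∀ γ : Γ, IsOfFinOrder γ)
    (l : Γ) (n : ℕ) (hn : 1 ≤ n)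
    (hl : ¬ ∃ (d : ℕ) (θ : Γ), d ∣ n ∧ 1 < d ∧ θ ^ d = l)
    (ζ : ℂ) (hζ : ζ ^ n = ((l : ℂˣ) : ℂ)) :
    (∃ m : ℕ, 1 ≤ m ∧ ζ ^ m = 1) ∧
    (∃ u : ℂˣ, u ∈ Γ ∧ (u : ℂ) = ζ ^ n) ∧
    (∀ w : ℕ, 1 ≤ w → w < n → ¬ ∃ u : ℂˣ, u ∈ Γ ∧ (u : ℂ) = ζ ^ w) := by
  have hζ0 : ζ ≠ 0 := by
    rintro rfl
    rw [zero_pow (by omega)] at hζ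
    exact (l : ℂˣ).ne_zero hζ.symm
  obtain ⟨z, rfl⟩ : ∃ z : ℂˣ, (z : ℂ) = ζ := ⟨Units.mk0 ζ hζ0, rfl⟩
  have hz : z ^ n = (l : ℂˣ) := by
    apply Units.ext
    rw [Units.val_pow_eq_pow_val]
    exact hζ
  refine ⟨?_, ⟨l, l.2, hζ.symm⟩, ?_⟩
  · obtain ⟨k, hk, hk1⟩ := (isOfFinOrder_iff_pow_eq_one).1 (hΓ l)
    refine ⟨n * k, Nat.mul_pos hn hk, ?_⟩
    have h1 : ((l : ℂˣ)) ^ k = 1 := by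
      have := congrArg (Subtype.val) hk1
      simpa using this
    rw [pow_mul, hζ, ← Units.val_pow_eq_pow_val, h1, Units.val_one]
  · rintro w hw hwn ⟨u, hu, huw⟩
    have hzw : z ^ w ∈ Γ := by
      have : u = z ^ w := by
        apply Units.ext
        rw [Units.val_pow_eq_pow_val]
        exact huw
      exact this ▸ hu
    have hzn : z ^ n ∈ Γ := hz ▸ l.2
    have hg : z ^ (Nat.gcd n w) ∈ Γ := by
      rw [← zpow_natCast, Nat.gcd_eq_gcd_ab, zpow_add, zpow_mul, zpow_mul, zpow_natCast,
        zpow_natCast]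
      exact Γ.mul_mem (Γ.zpow_mem hzn _) (Γ.zpow_mem hzw _)
    have hgn : Nat.gcd n w ∣ n := Nat.gcd_dvd_left n w
    have hgw : Nat.gcd n w ≤ w := Nat.gcd_le_right n hw
    obtain ⟨d, hd⟩ := hgn
    refine hl ⟨d, ⟨_, hg⟩, ⟨Nat.gcd n w, by rw [mul_comm]; exact hd⟩, ?_, ?_⟩
    · by_contra hlt
      have : n ≤ Nat.gcd n w * 1 := le_trans hd.le (Nat.mul_le_mul_left _ (by omega))
      omega
    · apply Subtype.ext
      change (z ^ (Nat.gcd n w)) ^ d = (l : ℂˣ)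
      rw [← pow_mul, ← hd, hz]
end

section
/- Let K be a field that is a cyclotomic extension of ℚ for all positive integers (IsCyclotomicExtension Set.univ ℚ K, i.e. K = ℚ(μ∞)). Let M be an intermediate field of K/ℚ that is generated over ℚ by the roots of unity it contains, i.e. M equals the intermediate field generated over ℚ by {x ∈ K | x ∈ M and x^k = 1 for some k ≥ 1}. Let ζ, ξ ∈ K be roots of unity (each has some positive power equal to 1) and let n ≥ 1 satisfy: ζ^n ∈ M, ξ^n ∈ M, ζ^w ∉ M and ξ^w ∉ M for all w with 1 ≤ w < n, and ζ^n = ξ^n. Then there exists an M-algebra automorphism σ of K (σ : K ≃ₐ[M] K) with σ ζ = ξ. (This is the key injectivity step in the theorem that for a closed subgroup Γ of Gal(ℚ(μ∞)/ℚ), the map Φ_{F_Γ} induces a continuous bijection from the Γ-quotient of the strong congruence space of the projective line over F_{1^∞} onto that over F_Γ.) -/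
theorem minpoly_rat_eq {K : Type*} [Field K] [Algebra ℚ K] [CharZero K] {z : K} {n : ℕ}
    (h : IsPrimitiveRoot z n) (hn : 0 < n) : minpoly ℚ z = Polynomial.cyclotomic n ℚ := by
  refine (minpoly.eq_of_irreducible_of_monic (Polynomial.cyclotomic.irreducible_rat hn) ?_
    (Polynomial.cyclotomic.monic n ℚ)).symm
  rw [Polynomial.aeval_def, ← Polynomial.eval_map, Polynomial.map_cyclotomic]
  exact h.isRoot_cyclotomic hn

/-- An element killed by roots-of-unity descent: there is one root of unity in `M` controlling `x`. -/
def CtrlBy {K : Type*} [Field K] [Algebra ℚ K] (M : IntermediateField ℚ K) (w x : K) : Prop :=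
  w ∈ M ∧ (∃ k : ℕ, 1 ≤ k ∧ w ^ k = 1) ∧ ∀ τ : K ≃ₐ[ℚ] K, τ w = w → τ x = x

theorem ctrl_combine {K : Type*} [Field K] [Algebra ℚ K] (M : IntermediateField ℚ K)
    (w₁ w₂ : K) (h₁ : w₁ ∈ M) (h₂ : w₂ ∈ M)
    (k₁ : ∃ k : ℕ, 1 ≤ k ∧ w₁ ^ k = 1) (k₂ : ∃ k : ℕ, 1 ≤ k ∧ w₂ ^ k = 1) :
    ∃ w ∈ M, (∃ k : ℕ, 1 ≤ k ∧ w ^ k = 1) ∧ (∃ i, w ^ i = w₁) ∧ ∃ i, w ^ i = w₂ := by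
  have o₁ : 0 < orderOf w₁ := orderOf_pos_iff.2 (isOfFinOrder_iff_pow_eq_one.2 k₁)
  have o₂ : 0 < orderOf w₂ := orderOf_pos_iff.2 (isOfFinOrder_iff_pow_eq_one.2 k₂)
  have hp := (IsPrimitiveRoot.orderOf w₁).pow_mul_pow_lcm (IsPrimitiveRoot.orderOf w₂) o₁.ne' o₂.ne'
  have hL : 0 < Nat.lcm (orderOf w₁) (orderOf w₂) := Nat.lcm_pos o₁ o₂
  haveI : NeZero (Nat.lcm (orderOf w₁) (orderOf w₂)) := ⟨hL.ne'⟩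
  refine ⟨_, mul_mem (pow_mem h₁ _) (pow_mem h₂ _), ⟨_, hL, hp.pow_eq_one⟩, ?_, ?_⟩
  · obtain ⟨i, -, hi⟩ := hp.eq_pow_of_pow_eq_one
      (orderOf_dvd_iff_pow_eq_one.1 (Nat.dvd_lcm_left (orderOf w₁) (orderOf w₂)))
    exact ⟨i, hi⟩
  · obtain ⟨i, -, hi⟩ := hp.eq_pow_of_pow_eq_one
      (orderOf_dvd_iff_pow_eq_one.1 (Nat.dvd_lcm_right (orderOf w₁) (orderOf w₂)))
    exact ⟨i, hi⟩

theorem ctrl_two {K : Type*} [Field K] [Algebra ℚ K] (M : IntermediateField ℚ K)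
    (w₁ w₂ x y : K) (h₁ : CtrlBy M w₁ x) (h₂ : CtrlBy M w₂ y) :
    ∃ w, CtrlBy M w x ∧ CtrlBy M w y := by
  obtain ⟨w, hw, hk, ⟨i, hi⟩, j, hj⟩ := ctrl_combine M w₁ w₂ h₁.1 h₂.1 h₁.2.1 h₂.2.1
  refine ⟨w, ⟨hw, hk, fun τ hτ => h₁.2.2 τ ?_⟩, ⟨hw, hk, fun τ hτ => h₂.2.2 τ ?_⟩⟩
  · rw [← hi, map_pow, hτ]
  · rw [← hj, map_pow, hτ]

theorem ctrl_exists {K : Type*} [Field K] [Algebra ℚ K] (M : IntermediateField ℚ K)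
    (hM : M = IntermediateField.adjoin ℚ {x : K | x ∈ M ∧ ∃ k : ℕ, 1 ≤ k ∧ x ^ k = 1})
    (x : K) (hx : x ∈ M) : ∃ w, CtrlBy M w x := by
  rw [hM] at hx
  induction hx using IntermediateField.adjoin_induction with
  | mem x hx => exact ⟨x, hx.1, hx.2, fun τ h => h⟩
  | algebraMap q => exact ⟨1, one_mem _, ⟨1, le_rfl, by simp⟩, fun τ _ => τ.commutes q⟩
  | add x y _ _ hx hy =>
    obtain ⟨w₁, h₁⟩ := hx
    obtain ⟨w₂, h₂⟩ := hy
    obtain ⟨w, h, h'⟩ := ctrl_two M w₁ w₂ x y h₁ h₂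
    exact ⟨w, h.1, h.2.1, fun τ hτ => by rw [map_add, h.2.2 τ hτ, h'.2.2 τ hτ]⟩
  | inv x _ hx =>
    obtain ⟨w, h⟩ := hx
    exact ⟨w, h.1, h.2.1, fun τ hτ => by rw [map_inv₀, h.2.2 τ hτ]⟩
  | mul x y _ _ hx hy =>
    obtain ⟨w₁, h₁⟩ := hx
    obtain ⟨w₂, h₂⟩ := hy
    obtain ⟨w, h, h'⟩ := ctrl_two M w₁ w₂ x y h₁ h₂
    exact ⟨w, h.1, h.2.1, fun τ hτ => by rw [map_mul, h.2.2 τ hτ, h'.2.2 τ hτ]⟩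

theorem ctrl_many {K : Type*} [Field K] [Algebra ℚ K] (M : IntermediateField ℚ K)
    (hM : M = IntermediateField.adjoin ℚ {x : K | x ∈ M ∧ ∃ k : ℕ, 1 ≤ k ∧ x ^ k = 1})
    (f : ℕ → K) (hf : ∀ i, f i ∈ M) (m : ℕ) :
    ∃ w ∈ M, (∃ k : ℕ, 1 ≤ k ∧ w ^ k = 1) ∧
      ∀ τ : K ≃ₐ[ℚ] K, τ w = w → ∀ i < m, τ (f i) = f i := by
  induction m with
  | zero => exact ⟨1, one_mem _, ⟨1, le_rfl, by simp⟩, fun τ _ i hi => by omega⟩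
  | succ m ih =>
    obtain ⟨w₁, h₁, k₁, t₁⟩ := ih
    obtain ⟨w₂, h₂, k₂, t₂⟩ := ctrl_exists M hM (f m) (hf m)
    obtain ⟨w, hw, hk, ⟨i, hi⟩, j, hj⟩ := ctrl_combine M w₁ w₂ h₁ h₂ k₁ k₂
    refine ⟨w, hw, hk, fun τ hτ l hl => ?_⟩
    rcases Nat.lt_succ_iff_lt_or_eq.1 hl with h | rfl
    · exact t₁ τ (by rw [← hi, map_pow, hτ]) l h
    · exact t₂ τ (by rw [← hj, map_pow, hτ])

theorem order_eq_mul {K : Type*} [Field K] [Algebra ℚ K] (M : IntermediateField ℚ K)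
    (ζ : K) (n : ℕ) (hn : 1 ≤ n) (hζn : ζ ^ n ∈ M)
    (hζ0 : ζ ≠ 0) (hζw : ∀ w : ℕ, 1 ≤ w → w < n → ζ ^ w ∉ M) :
    orderOf ζ = n * orderOf (ζ ^ n) := by
  have hd : n ∣ orderOf ζ := by
    by_contra hnd
    have hpos : 1 ≤ orderOf ζ % n := Nat.pos_of_ne_zero fun h => hnd (Nat.dvd_of_mod_eq_zero h)
    refine hζw _ hpos (Nat.mod_lt _ hn) ?_
    have h1 : (ζ ^ n) ^ (orderOf ζ / n) * ζ ^ (orderOf ζ % n) = 1 := by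
      rw [← pow_mul, ← pow_add, Nat.div_add_mod, pow_orderOf_eq_one]
    rw [eq_inv_of_mul_eq_one_right h1]
    exact inv_mem (pow_mem hζn _)
  rw [orderOf_pow_of_dvd (by omega) hd, Nat.mul_div_cancel' hd]

/-- let `K = ℚ(μ∞)` and let `M` be an intermediate field of `K/ℚ` generated
over `ℚ` by the roots of unity it contains. If `ζ, ξ ∈ K` are roots of unity and `n ≥ 1`
satisfies `ζ^n ∈ M`, `ξ^n ∈ M`, `ζ^w ∉ M` and `ξ^w ∉ M` for `1 ≤ w < n`, and `ζ^n = ξ^n`,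
then some `M`-algebra automorphism of `K` sends `ζ` to `ξ`. -/
theorem exists_aut_fixing_sending (K : Type*) [Field K] [Algebra ℚ K]
    [IsCyclotomicExtension Set.univ ℚ K]
    (M : IntermediateField ℚ K)
    (hM : M = IntermediateField.adjoin ℚ {x : K | x ∈ M ∧ ∃ k : ℕ, 1 ≤ k ∧ x ^ k = 1})
    (ζ ξ : K)
    (hζ : ∃ k : ℕ, 1 ≤ k ∧ ζ ^ k = 1) (hξ : ∃ k : ℕ, 1 ≤ k ∧ ξ ^ k = 1)
    (n : ℕ) (hn : 1 ≤ n)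
    (hζn : ζ ^ n ∈ M) (hξn : ξ ^ n ∈ M)
    (hζw : ∀ w : ℕ, 1 ≤ w → w < n → ζ ^ w ∉ M)
    (hξw : ∀ w : ℕ, 1 ≤ w → w < n → ξ ^ w ∉ M)
    (heq : ζ ^ n = ξ ^ n) :
    ∃ σ : K ≃ₐ[M] K, σ ζ = ξ := by
  classical
  haveI : CharZero K := algebraRat.charZero K
  haveI : IsGalois ℚ K := IsCyclotomicExtension.isGalois Set.univ ℚ K
  haveI : Normal M K := inferInstance
  have od : 0 < orderOf ζ := orderOf_pos_iff.2 (isOfFinOrder_iff_pow_eq_one.2 hζ)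
  have ne0 : ∀ x : K, (∃ k : ℕ, 1 ≤ k ∧ x ^ k = 1) → x ≠ 0 := by
    rintro x ⟨k, hk, h⟩ rfl
    rw [zero_pow (by omega)] at h
    exact zero_ne_one h
  have e1 := order_eq_mul M ζ n hn hζn (ne0 _ hζ) hζw
  have e2 := order_eq_mul M ξ n hn hξn (ne0 _ hξ) hξw
  have hord : orderOf ξ = orderOf ζ := by rw [e1, e2, heq]
  set p := minpoly M ζ with hp
  obtain ⟨w₁, hw₁, kw₁, tw₁⟩ := ctrl_many M hM (fun i => (p.coeff i : K)) (fun i => (p.coeff i).2)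
    (p.natDegree + 1)
  have ka : ∃ k : ℕ, 1 ≤ k ∧ (ζ ^ n) ^ k = 1 :=
    ⟨orderOf ζ, od, by rw [← pow_mul, mul_comm, pow_mul, pow_orderOf_eq_one, one_pow]⟩
  obtain ⟨w, hw, kw, ⟨i, hi⟩, j, hj⟩ := ctrl_combine M w₁ (ζ ^ n) hw₁ hζn kw₁ ka
  have oN : 0 < orderOf w := orderOf_pos_iff.2 (isOfFinOrder_iff_pow_eq_one.2 kw)
  have hgcd : Nat.gcd (orderOf ζ) (orderOf w) = orderOf (ζ ^ n) := by
    apply le_antisymm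
    · set h := Nat.gcd (orderOf ζ) (orderOf w) with hh
      have hhd : h ∣ orderOf ζ := Nat.gcd_dvd_left _ _
      have hpos : 0 < h := Nat.gcd_pos_of_pos_left _ od
      obtain ⟨c, hc⟩ := hhd
      have hc0 : 0 < c := Nat.pos_of_ne_zero fun h0 => od.ne' (by rw [hc, h0, mul_zero])
      have hmem : ζ ^ c ∈ M := by
        haveI : NeZero (orderOf w) := ⟨oN.ne'⟩
        have h1 : (ζ ^ c) ^ orderOf w = 1 := by
          obtain ⟨e, he⟩ : h ∣ orderOf w := Nat.gcd_dvd_right _ _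
          rw [he, ← pow_mul, ← mul_assoc, mul_comm c h, ← hc, pow_mul, pow_orderOf_eq_one, one_pow]
        obtain ⟨l, -, hl⟩ := (IsPrimitiveRoot.orderOf w).eq_pow_of_pow_eq_one h1
        rw [← hl]
        exact pow_mem hw l
      have hnc : n ≤ c := by
        by_contra hlt
        exact hζw c hc0 (by omega) hmem
      have h3 : h * c = n * orderOf (ζ ^ n) := by rw [← hc, e1]
      by_contra hlt
      nlinarith
    · refine Nat.le_of_dvd (Nat.gcd_pos_of_pos_left _ od) (Nat.dvd_gcd ⟨n, by rw [e1]; ring⟩ ?_)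
      rw [← hj]
      exact orderOf_pow_dvd j
  have hPζ := IsPrimitiveRoot.orderOf ζ
  have hPξ : IsPrimitiveRoot ξ (orderOf ζ) := hord ▸ IsPrimitiveRoot.orderOf ξ
  haveI : NeZero (orderOf ζ) := ⟨od.ne'⟩
  obtain ⟨u, -, hu⟩ := hPζ.eq_pow_of_pow_eq_one hPξ.pow_eq_one
  have hucop : u.Coprime (orderOf ζ) := (hPζ.pow_iff_coprime od u).1 (hu ▸ hPξ)
  have hu1 : u ≡ 1 [MOD Nat.gcd (orderOf ζ) (orderOf w)] := by
    rw [hgcd]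
    have h1 : ζ ^ (n * u) = ζ ^ (n * 1) := by
      rw [mul_one, mul_comm, pow_mul, hu, heq]
    rw [(isOfFinOrder_iff_pow_eq_one.2 hζ).pow_eq_pow_iff_modEq, e1] at h1
    exact Nat.ModEq.mul_left_cancel' (by omega) h1
  obtain ⟨v, hv1, hv2⟩ := Nat.chineseRemainder' hu1
  have hc1 : v.Coprime (orderOf ζ) := by
    rw [Nat.Coprime, hv1.gcd_eq]; exact hucop
  have hc2 : v.Coprime (orderOf w) := by
    rw [Nat.Coprime, hv2.gcd_eq]; simp
  have hc3 : v.Coprime (Nat.lcm (orderOf ζ) (orderOf w)) :=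
    (Nat.Coprime.mul_right hc1 hc2).coprime_dvd_right (Nat.lcm_dvd_mul _ _)
  have hz := hPζ.pow_mul_pow_lcm (IsPrimitiveRoot.orderOf w) od.ne' oN.ne'
  have hL : 0 < Nat.lcm (orderOf ζ) (orderOf w) := Nat.lcm_pos od oN
  have : NeZero (Nat.lcm (orderOf ζ) (orderOf w)) := ⟨hL.ne'⟩
  obtain ⟨a, -, ha⟩ := hz.eq_pow_of_pow_eq_one
      (orderOf_dvd_iff_pow_eq_one.1 (Nat.dvd_lcm_left (orderOf ζ) (orderOf w)))
  obtain ⟨b, -, hb⟩ := hz.eq_pow_of_pow_eq_one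
      (orderOf_dvd_iff_pow_eq_one.1 (Nat.dvd_lcm_right (orderOf ζ) (orderOf w)))
  generalize ζ ^ _ * w ^ _ = z at hz ha hb
  have hconj : IsConjRoot ℚ (z ^ v) z := by
    rw [isConjRoot_def, minpoly_rat_eq (hz.pow_of_coprime v hc3) hL, minpoly_rat_eq hz hL]
  obtain ⟨τ, hτ⟩ := hconj.exists_algEquiv
  have hτζ : τ ζ = ξ := by
    calc τ ζ = (z ^ a) ^ v := by rw [← ha, map_pow, hτ, ← pow_mul, ← pow_mul, mul_comm]
      _ = ζ ^ v := by rw [ha]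
      _ = ζ ^ u := (isOfFinOrder_iff_pow_eq_one.2 hζ).pow_eq_pow_iff_modEq.2 hv1
      _ = ξ := hu
  have hτw : τ w = w := by
    calc τ w = (z ^ b) ^ v := by rw [← hb, map_pow, hτ, ← pow_mul, ← pow_mul, mul_comm]
      _ = w ^ v := by rw [hb]
      _ = w ^ 1 := (isOfFinOrder_iff_pow_eq_one.2 kw).pow_eq_pow_iff_modEq.2 hv2
      _ = w := pow_one w
  have hτc := tw₁ τ (by rw [← hi, map_pow, hτw])
  have hroot : Polynomial.aeval ξ p = 0 := by
    have h0 : Polynomial.aeval ζ p = 0 := minpoly.aeval M ζ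
    have h1 := congrArg τ h0
    rw [Polynomial.aeval_eq_sum_range, map_sum, map_zero] at h1
    rw [Polynomial.aeval_eq_sum_range, ← h1]
    refine Finset.sum_congr rfl fun l hl => ?_
    have h2 := hτc l (Finset.mem_range.1 hl)
    rw [Algebra.smul_def, Algebra.smul_def, map_mul, map_pow, hτζ]
    exact congrArg (· * ξ ^ l) h2.symm
  have hint : IsIntegral M ζ := Algebra.IsIntegral.isIntegral ζ
  exact (isConjRoot_of_aeval_eq_zero hint hroot).symm.exists_algEquiv
end

section
/- Let Γ = {1, -1} be the subgroup of ℂˣ of order 2, and let ι : M₀ →*₀ M(Γ) be the monoid-with-zero homomorphism sending the nonzero element ofAdd k to (1, ofAdd k). Then the pullback map c ↦ (pullback of c along ι) is a bijection from the set of Γ-congruences on M(Γ) onto the set of strong prime congruences on M₀. (This is the affine content of the remark that Ψ_{F_{1²}} : P̃¹_{F_{1²}} → P̃¹_{F₁} is a homeomorphism.) -/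
open Multiplicative

theorem exists_complex_aux {K : Type} [Field K] (a : K) :
    ∃ z : ℂ, (∀ i j : ℕ, z ^ i = z ^ j ↔ a ^ i = a ^ j) ∧ (∀ i : ℕ, z ^ i = 0 ↔ a ^ i = 0) := by
  by_cases ha : a = 0
  · subst ha
    refine ⟨0, fun i j => ?_, fun i => ?_⟩
    · rcases Nat.eq_zero_or_pos i with rfl | hi <;> rcases Nat.eq_zero_or_pos j with rfl | hj <;>
        simp_all [Nat.pos_iff_ne_zero]
    · simp
  · have key : ∃ w : ℂˣ, orderOf w = orderOf (Units.mk0 a ha) := by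
      rcases Nat.eq_zero_or_pos (orderOf (Units.mk0 a ha)) with h | h
      · refine ⟨Units.mk0 2 two_ne_zero, ?_⟩
        rw [h, orderOf_eq_zero_iff']
        intro n hn he
        have h2 := congrArg (fun u : ℂˣ => (u : ℂ)) he
        simp only [Units.val_pow_eq_pow_val, Units.val_mk0, Units.val_one] at h2
        have h3 : (2 : ℕ) ^ n = 1 := by exact_mod_cast h2
        have := Nat.one_lt_two_pow hn.ne'
        omega
      · have hp := Complex.isPrimitiveRoot_exp _ h.ne'
        refine ⟨Units.mk0 _ (hp.ne_zero h.ne'), ?_⟩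
        rw [← orderOf_units, Units.val_mk0]
        exact hp.eq_orderOf.symm
    obtain ⟨w, hw⟩ := key
    refine ⟨w, fun i j => ?_, fun i => ?_⟩
    · have h1 : (w : ℂ) ^ i = (w : ℂ) ^ j ↔ w ^ i = w ^ j := by
        rw [Units.ext_iff]; simp
      have h2 : a ^ i = a ^ j ↔ (Units.mk0 a ha) ^ i = (Units.mk0 a ha) ^ j := by
        rw [Units.ext_iff]; simp
      rw [h1, h2, pow_eq_pow_iff_modEq, pow_eq_pow_iff_modEq, hw]
    · simp [ha]

theorem neg_aux {M : Type} [CommMonoidWithZero M] {N : Type} [CommMonoidWithZero N]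
    {K L : Type} [Field K] [Field L] (ι : N →*₀ M) (f : M →*₀ K) (g : M →*₀ L)
    (h : ∀ x y, f (ι x) = f (ι y) ↔ g (ι x) = g (ι y)) (e : M) (he : f e = -1) (he1 : (-1 : K) ≠ 1)
    (hg : g e = -1)
    (hM : ∀ x, ∃ u, x = ι u ∨ x = e * ι u) (x y : M) (hxy : f x = f y) : g x = g y := by
  have key : ∀ u v, f (ι u) = - f (ι v) → g (ι u) = - g (ι v) := by
    intro u v huv
    have h2 : f (ι (u ^ 2)) = f (ι (v ^ 2)) := by simp [huv]
    rw [h] at h2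
    simp only [map_pow] at h2
    rcases sq_eq_sq_iff_eq_or_eq_neg.1 h2 with h3 | h3
    · have h4 := (h u v).2 h3
      have h5 : f (ι v) = 0 := by
        by_contra h0
        apply he1
        apply mul_right_cancel₀ h0
        rw [neg_one_mul, one_mul, ← huv, h4]
      have h6 : f (ι u) = 0 := by rw [h4, h5]
      have e1 : g (ι v) = g (ι 0) := (h v 0).1 (by simp [h5])
      have e2 : g (ι u) = g (ι 0) := (h u 0).1 (by simp [h6])
      simp [e1, e2]
    · exact h3
  obtain ⟨u, rfl | rfl⟩ := hM x <;> obtain ⟨v, rfl | rfl⟩ := hM y <;>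
    (try simp only [map_mul, he, hg, neg_one_mul, neg_inj] at hxy ⊢)
  · exact (h _ _).1 hxy
  · exact key _ _ hxy
  · rw [key v u hxy.symm]
  · exact (h _ _).1 hxy

/-- for `Γ = {1, -1} ≤ ℂˣ` and the induced map `ι : F₁[T] →*₀ Γ[T]`,
pullback along `ι` is a bijection from the set of `Γ`-congruences on `Γ[T]` onto the set
of strong prime congruences on `F₁[T]`. -/
theorem comap_bijOn_F12 (Γ : Subgroup ℂˣ) (hΓ : (Γ : Set ℂˣ) = {1, -1})
    (ι : M0 →*₀ MGamma Γ)
    (hι : ∀ k : Multiplicative ℕ,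
      ι ((k : Multiplicative ℕ) : M0) = ((((1 : Γ), k) : Γ × Multiplicative ℕ) : MGamma Γ)) :
    Set.BijOn (fun c : Con (MGamma Γ) => Con.comap ι (map_mul ι) c)
      {c | IsGammaCon Γ c} {c | IsStrongPrimeCon c} := by
  have hmem : ∀ γ : ℂˣ, γ ∈ Γ ↔ γ = 1 ∨ γ = -1 := fun γ => by
    rw [← SetLike.mem_coe, hΓ]; simp
  have hm1 : (-1 : ℂˣ) ∈ Γ := (hmem _).2 (Or.inr rfl)
  let ε : Γ := ⟨-1, hm1⟩
  have hε1 : ε ≠ 1 := by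
    intro h
    have h2 := congrArg (fun u : Γ => ((u : ℂˣ) : ℂ)) h
    norm_num [ε] at h2
  have hcone : constE (1 : Γ) = 1 := rfl
  have hεε : constE ε * constE ε = 1 := by
    have : ε * ε = 1 := by ext; simp [ε]
    have h2 : ((ε, ofAdd 0) : Γ × Multiplicative ℕ) * (ε, ofAdd 0) = 1 := by
      ext1
      · exact this
      · rfl
    unfold constE
    rw [← WithZero.coe_mul, h2, WithZero.coe_one]
  have hM : ∀ x : MGamma Γ, ∃ u, x = ι u ∨ x = constE ε * ι u := by
    intro x
    induction x using WithZero.recZeroCoe with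
    | zero => exact ⟨0, by simp⟩
    | coe p =>
      obtain ⟨⟨γ, hγ⟩, k⟩ := p
      refine ⟨(k : M0), ?_⟩
      rw [hι]
      rcases (hmem γ).1 hγ with rfl | rfl
      · left; rfl
      · right
        unfold constE
        rw [← WithZero.coe_mul, Prod.mk_mul_mk, mul_one, ofAdd_zero, one_mul]
  have hneg : ∀ (K : Type) (_ : Field K) (f : MGamma Γ →*₀ K),
      (∀ γ δ : Γ, Con.ker f.toMonoidHom (constE γ) (constE δ) → γ = δ) →
      f (constE ε) = -1 ∧ (-1 : K) ≠ 1 := by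
    intro K _ f hf
    have h1 : f (constE ε) * f (constE ε) = 1 := by rw [← map_mul, hεε, map_one]
    have h2 : f (constE ε) ≠ 1 := by
      intro h
      apply hε1
      apply hf
      rw [Con.ker_rel, hcone]
      change f _ = f 1
      rw [h, map_one]
    rcases mul_self_eq_one_iff.1 h1 with h3 | h3
    · exact absurd h3 h2
    · exact ⟨h3, h3 ▸ h2⟩
  refine ⟨?_, ?_, ?_⟩
  · rintro c ⟨⟨K, hK, f, rfl⟩, -⟩
    exact ⟨K, hK, f.comp ι, rfl⟩
  · rintro c ⟨⟨K, hK, f, rfl⟩, hf⟩ d ⟨⟨L, hL, g, rfl⟩, hg⟩ hcd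
    obtain ⟨f1, f2⟩ := hneg K hK f hf
    obtain ⟨g1, g2⟩ := hneg L hL g hg
    have h : ∀ x y, f (ι x) = f (ι y) ↔ g (ι x) = g (ι y) := by
      intro x y
      exact iff_of_eq (congrArg (fun c : Con M0 => c x y) hcd)
    ext x y
    exact ⟨neg_aux ι f g h _ f1 f2 g1 hM x y, neg_aux ι g f (fun x y => (h x y).symm) _ g1 g2 f1 hM x y⟩
  · rintro c ⟨K, hK, f, rfl⟩
    obtain ⟨z, hz, hz0⟩ := exists_complex_aux (f ((ofAdd 1 : Multiplicative ℕ) : M0))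
    have hfk : ∀ k : Multiplicative ℕ,
        f (k : M0) = f ((ofAdd 1 : Multiplicative ℕ) : M0) ^ (toAdd k) := by
      intro k
      rw [← map_pow, ← WithZero.coe_pow, ← ofAdd_nsmul]
      simp
    let g0 : Γ × Multiplicative ℕ →* ℂ :=
      ((Units.coeHom ℂ).comp Γ.subtype).coprod (powersHom ℂ z)
    let g : MGamma Γ →*₀ ℂ := WithZero.lift' g0
    have hg : ∀ p : Γ × Multiplicative ℕ,
        g (p : MGamma Γ) = ((p.1 : ℂˣ) : ℂ) * z ^ (toAdd p.2) := by
      intro p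
      simp [g, g0]
    refine ⟨Con.ker g.toMonoidHom, ⟨⟨ℂ, inferInstance, g, rfl⟩, ?_⟩, ?_⟩
    · intro γ δ h
      have h' : g (constE γ) = g (constE δ) := h
      unfold constE at h'
      rw [hg, hg] at h'
      ext
      simpa using h'
    · ext x y
      change g (ι x) = g (ι y) ↔ f x = f y
      induction x using WithZero.recZeroCoe with
      | zero =>
        induction y using WithZero.recZeroCoe with
        | zero => simp
        | coe l =>
          rw [hι, hg, hfk, map_zero, map_zero, map_zero, eq_comm, @eq_comm _ (0 : K)]
          simpa using hz0 (toAdd l)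
      | coe k =>
        induction y using WithZero.recZeroCoe with
        | zero =>
          rw [hι, hg, hfk, map_zero, map_zero, map_zero]
          simpa using hz0 (toAdd k)
        | coe l =>
          rw [hι, hι, hg, hg, hfk, hfk l]
          simpa using hz (toAdd k) (toAdd l)
end

section
/- Let K be a field and let u ∈ Kˣ be a unit of finite multiplicative order n ≥ 1. Let f : M₀ →*₀ K be the monoid-with-zero homomorphism sending the nonzero element ofAdd k to u^k (and 0 to 0). Then the congruence kernel of f equals conGen {(T^n, 1)}. (This is the computation showing that for a nonzero prime P of O_K[f] with f ∉ P, the induced point f̃(P) of the strong congruence space of the projective line over F₁ is [n], where n is the order of the image of f in the residue field.) -/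
open Multiplicative

/-- let `K` be a field and `u ∈ Kˣ` a unit of finite multiplicative order
`n ≥ 1`. The congruence kernel of `f : F₁[T] →*₀ K`, `T^k ↦ u^k`, equals `⟨T^n ~ 1⟩`. -/
theorem congKer_unit_pow (K : Type*) [Field K] (u : Kˣ) (n : ℕ) (hn : 1 ≤ n)
    (hord : orderOf u = n)
    (f : M0 →*₀ K)
    (hf : ∀ k : ℕ, f (((ofAdd k : Multiplicative ℕ) : M0)) = (u : K) ^ k) :
    Con.ker f.toMonoidHom = conGenPair (T0 ^ n) 1 := by
  have hT : ∀ k : ℕ, T0 ^ k = (((ofAdd k : Multiplicative ℕ) : M0)) := by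
    intro k
    rw [T0, ← WithZero.coe_pow, ← ofAdd_nsmul]
    simp
  have hfT : ∀ k : ℕ, f (T0 ^ k) = (u : K) ^ k := fun k => by rw [hT, hf]
  have hun : (u : K) ^ n = 1 := by
    rw [← Units.val_pow_eq_pow_val, ← hord, pow_orderOf_eq_one, Units.val_one]
  have hred : ∀ k : ℕ, conGenPair (T0 ^ n) 1 (T0 ^ k) (T0 ^ (k % n)) := by
    intro k
    have h1 : conGenPair (T0 ^ n) 1 (T0 ^ n) 1 := ConGen.Rel.of _ _ ⟨rfl, rfl⟩
    have h2 := (conGenPair (T0 ^ n) 1).mul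
      ((conGenPair (T0 ^ n) 1).refl (T0 ^ (k % n))) ((conGenPair (T0 ^ n) 1).pow (k / n) h1)
    rw [one_pow, mul_one, ← pow_mul, ← pow_add, Nat.mod_add_div] at h2
    exact h2
  have hcases : ∀ x : M0, x = 0 ∨ ∃ k : ℕ, x = T0 ^ k := by
    intro x
    induction x using WithZero.recZeroCoe with
    | zero => exact Or.inl rfl
    | coe a => exact Or.inr ⟨toAdd a, by rw [hT]; rfl⟩
  have hne : ∀ k : ℕ, (u : K) ^ k ≠ 0 := fun k => pow_ne_zero _ u.ne_zero
  apply le_antisymm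
  · intro x y hxy
    have hxy' : f x = f y := hxy
    rcases hcases x with rfl | ⟨k, rfl⟩ <;> rcases hcases y with rfl | ⟨l, rfl⟩
    · exact (conGenPair (T0 ^ n) 1).refl _
    · rw [map_zero, hfT] at hxy'
      exact absurd hxy'.symm (hne l)
    · rw [map_zero, hfT] at hxy'
      exact absurd hxy' (hne k)
    · rw [hfT, hfT] at hxy'
      have h3 : u ^ k = u ^ l := Units.ext (by simpa using hxy')
      rw [pow_eq_pow_iff_modEq, hord] at h3
      have h4 : k % n = l % n := h3
      have h5 := hred k
      rw [h4] at h5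
      exact (conGenPair (T0 ^ n) 1).trans h5 ((conGenPair (T0 ^ n) 1).symm (hred l))
  · refine Con.conGen_le.2 ?_
    rintro x y ⟨rfl, rfl⟩
    change f (T0 ^ n) = f 1
    rw [hfT, hun, map_one]
end
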